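/- arXiv:2601.09447 — 4 statements merged into one kernel-verified Lean document; each statement's English description precedes it below -/
import Mathlib

section
/- For every integer n ≥ 29 with n ≡ 5 (mod 12), there exists a sequence of flips of length exactly (3n+3)/2 that transforms the burnt stack Ī_n = [-1, -2, ..., -n] into the sorted stack I_n = [1, 2, ..., n]. -/
/-- The flip of the top `k` pancakes of a burnt pancake stack `l`. -/
def pancakeFlip (k : ℕ) (l : List ℤ) : List ℤ :=
  ((l.take k).map Neg.neg).reverse ++ l.drop k

/-- Apply a sequence of flips (given by their sizes) successively to a stack. -/
def applyFlips (ks : List ℕ) (l : List ℤ) : List ℤ :=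
  ks.foldl (fun s k => pancakeFlip k s) l

/-- The sorted stack `I_n = [1, 2, ..., n]`. -/
def sortedStack (n : ℕ) : List ℤ := (List.range n).map (fun i => (i : ℤ) + 1)

/-- The reversed burnt stack `Ī_n = [-1, -2, ..., -n]`. -/
def burntStack (n : ℕ) : List ℤ := (List.range n).map (fun i => -((i : ℤ) + 1))

/-- A sequence of flips, each of size between `1` and `n`, transforming `Ī_n` into `I_n`. -/
def IsSortingSeq (n : ℕ) (ks : List ℕ) : Prop :=
  (∀ k ∈ ks, 1 ≤ k ∧ k ≤ n) ∧ applyFlips ks (burntStack n) = sortedStack n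

/-- `T n` is the minimum number of flips transforming `Ī_n` into `I_n`. -/
noncomputable def T (n : ℕ) : ℕ :=
  sInf {m | ∃ ks : List ℕ, IsSortingSeq n ks ∧ ks.length = m}

/-- The burnt stack segment obtained by turning a segment upside down. -/
def turn (l : List ℤ) : List ℤ := (l.map Neg.neg).reverse

theorem turn_append (a b : List ℤ) : turn (a ++ b) = turn b ++ turn a := by
  simp [turn]

theorem turn_cons (x : ℤ) (l : List ℤ) : turn (x :: l) = turn l ++ [-x] := by
  simp [turn]

theorem turn_nil : turn [] = [] := rfl

theorem turn_turn (l : List ℤ) : turn (turn l) = l := by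
  simp [turn, List.map_reverse]

theorem turn_flatMap {α : Type*} (js : List α) (f : α → List ℤ) :
    turn (js.flatMap f) = js.reverse.flatMap (fun j => turn (f j)) := by
  induction js with
  | nil => rfl
  | cons j js ih => simp [turn_append, ih]

theorem turn_eq_nil {l : List ℤ} : turn l = [] ↔ l = [] := by
  simp [turn]

/-- `Reach c l m`: some sequence of exactly `c` admissible flips transforms `l` into `m`. -/
def Reach (c : ℕ) (l m : List ℤ) : Prop :=
  ∃ ks : List ℕ, ks.length = c ∧ (∀ k ∈ ks, 1 ≤ k ∧ k ≤ l.length) ∧ applyFlips ks l = m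

theorem length_pancakeFlip (k : ℕ) (l : List ℤ) : (pancakeFlip k l).length = l.length := by
  simp [pancakeFlip]
  omega

theorem length_applyFlips (ks : List ℕ) (l : List ℤ) : (applyFlips ks l).length = l.length := by
  induction ks generalizing l with
  | nil => rfl
  | cons k ks ih => exact (ih (pancakeFlip k l)).trans (length_pancakeFlip k l)

namespace Reach

theorem refl (l : List ℤ) : Reach 0 l l := ⟨[], rfl, by simp, rfl⟩

theorem cast {c d : ℕ} {l l' m m' : List ℤ} (h : Reach c l l') (hc : c = d) (hl : l = m)
    (hl' : l' = m') : Reach d m m' := by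
  subst hc hl hl'
  exact h

theorem trans {c d : ℕ} {l₁ l₂ l₃ : List ℤ} (h : Reach c l₁ l₂) (h' : Reach d l₂ l₃) :
    Reach (c + d) l₁ l₃ := by
  obtain ⟨ks, rfl, hk, rfl⟩ := h
  obtain ⟨ms, rfl, hm, rfl⟩ := h'
  refine ⟨ks ++ ms, by simp, ?_, by simp [applyFlips]⟩
  intro k hmem
  rcases List.mem_append.1 hmem with h | h
  · exact hk k h
  · simpa only [length_applyFlips] using hm k h

theorem turn_prefix (a b : List ℤ) (ha : a ≠ []) : Reach 1 (a ++ b) (turn a ++ b) := by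
  refine ⟨[a.length], rfl, ?_, by simp [applyFlips, pancakeFlip, turn]⟩
  have := List.length_pos_of_ne_nil ha
  simp
  omega

/-- A flip of the prefix `a`, where the stacks are given up to propositional equality. -/
theorem step {c : ℕ} {l l₁ l₂ : List ℤ} (a b : List ℤ) (ha : a ≠ []) (hl : l = a ++ b)
    (hl₁ : turn a ++ b = l₁) (h : Reach c l₁ l₂) : Reach (c + 1) l l₂ := by
  subst hl hl₁
  exact ((turn_prefix a b ha).trans h).cast (add_comm 1 c) rfl rfl

end Reach

/-- The substitution of stack segments for the symbols of a symbolic stack: the symbol `x > 0`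
stands for `τ x`, and `-x` for the same segment turned upside down. -/
def expand (τ : ℕ → List ℤ) (l : List ℤ) : List ℤ :=
  l.flatMap fun x => if 0 < x then τ x.natAbs else turn (τ x.natAbs)

theorem expand_append (τ : ℕ → List ℤ) (a b : List ℤ) :
    expand τ (a ++ b) = expand τ a ++ expand τ b := by
  simp [expand]

theorem expand_cons (τ : ℕ → List ℤ) (x : ℤ) (l : List ℤ) :
    expand τ (x :: l) = (if 0 < x then τ x.natAbs else turn (τ x.natAbs)) ++ expand τ l := by
  simp [expand]

theorem turn_expand (τ : ℕ → List ℤ) (l : List ℤ) (h : 0 ∉ l) :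
    turn (expand τ l) = expand τ (turn l) := by
  induction l with
  | nil => rfl
  | cons x l ih =>
    simp only [List.mem_cons, not_or] at h
    rw [expand_cons, turn_append, ih h.2, turn_cons, expand_append, expand_cons]
    rcases lt_or_gt_of_ne h.1 with hx | hx
    · simp [hx, hx.le, not_lt.2, expand]
    · simp [hx, hx.le, not_lt.2, turn_turn, expand]

theorem expand_ne_nil {τ : ℕ → List ℤ} (hτ : ∀ k, τ k ≠ []) {l : List ℤ} (hl : l ≠ []) :
    expand τ l ≠ [] := by
  cases l with
  | nil => exact absurd rfl hl
  | cons x l =>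
    rw [expand_cons]
    split_ifs <;> simp [turn_eq_nil, hτ]

/-- Flips of a symbolic stack are realised by flips of the expanded stack. -/
theorem reach_expand_applyFlips {τ : ℕ → List ℤ} (hτ : ∀ k, τ k ≠ []) (w : List ℕ) (l : List ℤ)
    (h₀ : 0 ∉ l) (hw : ∀ k ∈ w, 1 ≤ k ∧ k ≤ l.length) :
    Reach w.length (expand τ l) (expand τ (applyFlips w l)) := by
  induction w generalizing l with
  | nil => exact Reach.refl _
  | cons k w ih =>
    have hk := hw k (by simp)
    have h₁ : 0 ∉ l.take k := fun h => h₀ (List.mem_of_mem_take h)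
    have h₂ : 0 ∉ pancakeFlip k l := by
      have h₃ : 0 ∉ l.drop k := fun h => h₀ (List.mem_of_mem_drop h)
      simpa [pancakeFlip, h₃] using fun h => h₁ (by simpa [← List.map_take] using h)
    have hne : l.take k ≠ [] := by
      rw [← List.length_pos_iff, List.length_take]
      omega
    refine Reach.step (expand τ (l.take k)) (expand τ (l.drop k)) (expand_ne_nil hτ hne) ?_ ?_
      (ih (pancakeFlip k l) h₂ ?_)
    · rw [← expand_append, List.take_append_drop]
    · rw [turn_expand τ _ h₁, ← expand_append]
      rfl
    · intro m hm
      rw [length_pancakeFlip]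
      exact hw m (by simp [hm])

/-- The offsets `8, 16, ..., 8 * r` of `r` inserted octets; the octet with offset `c` consists of
the pancakes `c + 1, ..., c + 8`. -/
def offsets (r : ℕ) : List ℤ := (List.range r).map fun i => 8 * ((i : ℤ) + 1)

/-- The meaning of the symbols in the symbolic stacks: the symbols `1, ..., 8` are pancakes,
the symbols `100, ..., 106` are segments made of pieces of the `r` octets, and every other symbol
is a pancake below the octets in the sorted stack. -/
def block (r : ℕ) : ℕ → List ℤ
  | 100 => (offsets r).flatMap fun c => [-(c + 1), -(c + 2), -(c + 3), -(c + 4), -(c + 5),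
      -(c + 6), -(c + 7), -(c + 8)]
  | 101 => (offsets r).flatMap fun c => [-(c + 6), -(c + 7), -(c + 2), -(c + 3)]
  | 102 => (offsets r).reverse.flatMap fun c => [c + 8, c + 5, c + 4, c + 1]
  | 103 => (offsets r).reverse.flatMap fun c => [c + 3, c + 4, c + 1, c + 2, c + 7, c + 8,
      c + 5, c + 6]
  | 104 => (offsets r).reverse.flatMap fun c => [-(c + 8), -(c + 7), -(c + 2), -(c + 1)]
  | 105 => (offsets r).reverse.flatMap fun c => [c + 3, c + 4, c + 5, c + 6]
  | 106 => (offsets r).flatMap fun c => [c + 1, c + 2, c + 3, c + 4, c + 5, c + 6, c + 7, c + 8]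
  | k => if k ≤ 8 then [(k : ℤ)] else [(k : ℤ) + 8 * r]

theorem block_ne_nil {r : ℕ} (hr : 1 ≤ r) (k : ℕ) : block r k ≠ [] := by
  obtain ⟨r, rfl⟩ := Nat.exists_eq_add_of_le' hr
  have h : offsets (r + 1) = 8 :: (offsets (r + 1)).tail := by
    simp [offsets, List.range_succ_eq_map]
  unfold block
  split <;> first | (split_ifs <;> simp) | (rw [h]; simp)

theorem reach_expand {r : ℕ} (hr : 1 ≤ r) (w : List ℕ) (l l' : List ℤ) (h₀ : 0 ∉ l)
    (hw : ∀ k ∈ w, 1 ≤ k ∧ k ≤ l.length) (h : applyFlips w l = l') :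
    Reach w.length (expand (block r) l) (expand (block r) l') :=
  h ▸ reach_expand_applyFlips (block_ne_nil hr) w l h₀ hw

theorem reach_cut_octet (c : ℤ) (X Y : List ℤ) :
    Reach 4 (X ++ [c + 8, c + 7, c + 6, c + 5, c + 4, c + 3, c + 2, c + 1] ++ Y)
      ([-(c + 6), -(c + 7), -(c + 2), -(c + 3)] ++ X ++ [c + 8, c + 5, c + 4, c + 1] ++ Y) := by
  refine Reach.step (X ++ [c + 8, c + 7, c + 6, c + 5, c + 4]) ([c + 3, c + 2, c + 1] ++ Y)
    (by simp) (by simp) rfl ?_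
  refine Reach.step
    ([-(c + 4), -(c + 5), -(c + 6), -(c + 7), -(c + 8)] ++ turn X ++ [c + 3, c + 2])
    ([c + 1] ++ Y) (by simp) (by simp [turn_append, turn_cons, turn_nil]) rfl ?_
  refine Reach.step ([-(c + 2), -(c + 3)] ++ X ++ [c + 8])
    ([c + 7, c + 6, c + 5, c + 4, c + 1] ++ Y) (by simp)
    (by simp [turn_append, turn_cons, turn_nil, turn_turn]) rfl ?_
  refine Reach.step ([-(c + 8)] ++ turn X ++ [c + 3, c + 2, c + 7, c + 6])
    ([c + 5, c + 4, c + 1] ++ Y) (by simp)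
    (by simp [turn_append, turn_cons, turn_nil]) ?_ (Reach.refl _)
  simp [turn_append, turn_cons, turn_nil, turn_turn]

theorem reach_exchange_octet (c : ℤ) (X Y : List ℤ) :
    Reach 4 ([-(c + 1), -(c + 4), -(c + 5), -(c + 8)] ++ X ++ [c + 3, c + 2, c + 7, c + 6] ++ Y)
      (X ++ [c + 3, c + 4, c + 1, c + 2, c + 7, c + 8, c + 5, c + 6] ++ Y) := by
  refine Reach.step ([-(c + 1), -(c + 4), -(c + 5), -(c + 8)] ++ X ++ [c + 3])
    ([c + 2, c + 7, c + 6] ++ Y) (by simp) (by simp) rfl ?_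
  refine Reach.step ([-(c + 3)] ++ turn X ++ [c + 8, c + 5])
    ([c + 4, c + 1, c + 2, c + 7, c + 6] ++ Y) (by simp)
    (by simp [turn_append, turn_cons, turn_nil]) rfl ?_
  refine Reach.step ([-(c + 5), -(c + 8)] ++ X ++ [c + 3, c + 4, c + 1, c + 2, c + 7])
    ([c + 6] ++ Y) (by simp) (by simp [turn_append, turn_cons, turn_nil, turn_turn]) rfl ?_
  refine Reach.step ([-(c + 7), -(c + 2), -(c + 1), -(c + 4), -(c + 3)] ++ turn X)
    ([c + 8, c + 5, c + 6] ++ Y) (by simp)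
    (by simp [turn_append, turn_cons, turn_nil]) ?_ (Reach.refl _)
  simp [turn_cons, turn_turn]

theorem reach_join_octet_outer (c : ℤ) (X Y : List ℤ) :
    Reach 2 (X ++ [c + 3, c + 4, c + 1, c + 2, c + 7, c + 8, c + 5, c + 6] ++ Y)
      ([-(c + 8), -(c + 7), -(c + 2), -(c + 1)] ++ X ++ [c + 3, c + 4, c + 5, c + 6] ++ Y) := by
  refine Reach.step (X ++ [c + 3, c + 4]) ([c + 1, c + 2, c + 7, c + 8, c + 5, c + 6] ++ Y)
    (by simp) (by simp) rfl ?_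
  refine Reach.step ([-(c + 4), -(c + 3)] ++ turn X ++ [c + 1, c + 2, c + 7, c + 8])
    ([c + 5, c + 6] ++ Y) (by simp) (by simp [turn_append, turn_cons, turn_nil]) ?_ (Reach.refl _)
  simp [turn_append, turn_cons, turn_nil, turn_turn]

theorem reach_join_octet_inner (c : ℤ) (X Y : List ℤ) :
    Reach 2 ([-(c + 6), -(c + 5), -(c + 4), -(c + 3)] ++ X ++ [c + 1, c + 2, c + 7, c + 8] ++ Y)
      (X ++ [c + 1, c + 2, c + 3, c + 4, c + 5, c + 6, c + 7, c + 8] ++ Y) := by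
  refine Reach.step ([-(c + 6), -(c + 5), -(c + 4), -(c + 3)] ++ X ++ [c + 1, c + 2])
    ([c + 7, c + 8] ++ Y) (by simp) (by simp) rfl ?_
  refine Reach.step ([-(c + 2), -(c + 1)] ++ turn X)
    ([c + 3, c + 4, c + 5, c + 6, c + 7, c + 8] ++ Y) (by simp)
    (by simp [turn_append, turn_cons, turn_nil]) ?_ (Reach.refl _)
  simp [turn_cons, turn_turn]

/-- Iterate a gadget that consumes `u c` behind the current top part `X`, and leaves `p c` above
and `q c` below `X`. -/
theorem reach_iterate_wrap {k : ℕ} {u p q : ℤ → List ℤ}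
    (h : ∀ c X Y, Reach k (X ++ u c ++ Y) (p c ++ X ++ q c ++ Y)) (cs X Y : List ℤ) :
    Reach (k * cs.length) (X ++ cs.flatMap u ++ Y)
      (cs.reverse.flatMap p ++ X ++ cs.flatMap q ++ Y) := by
  induction cs generalizing X with
  | nil => simpa using Reach.refl _
  | cons c cs ih =>
    refine ((h c X (cs.flatMap u ++ Y)).trans
      ((ih (p c ++ X ++ q c)).cast rfl ?_ rfl)).cast ?_ ?_ ?_
    · simp
    · simp
      ring
    · simp
    · simp

/-- Iterate a gadget that consumes `u c` in front of the rest `Y`, and leaves `p c` above the top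
part `X` and `q c` in front of `Y`. -/
theorem reach_iterate_wrap_reverse {k : ℕ} {u p q : ℤ → List ℤ}
    (h : ∀ c X Y, Reach k (X ++ u c ++ Y) (p c ++ X ++ q c ++ Y)) (cs X Y : List ℤ) :
    Reach (k * cs.length) (X ++ cs.reverse.flatMap u ++ Y)
      (cs.reverse.flatMap p ++ X ++ cs.reverse.flatMap q ++ Y) := by
  induction cs generalizing X Y with
  | nil => simpa using Reach.refl _
  | cons c cs ih =>
    refine ((h c (X ++ cs.reverse.flatMap u) Y).trans
      ((ih (p c ++ X) (q c ++ Y)).cast rfl ?_ rfl)).cast ?_ ?_ ?_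
    · simp
    · simp
      ring
    · simp
    · simp

/-- Iterate a gadget that merges `u c` on top with `v c` in front of the rest `Y`, where the
gadgets are nested. -/
theorem reach_iterate_nested {k : ℕ} {u v q : ℤ → List ℤ}
    (h : ∀ c X Y, Reach k (u c ++ X ++ v c ++ Y) (X ++ q c ++ Y)) (cs X Y : List ℤ) :
    Reach (k * cs.length) (cs.flatMap u ++ X ++ cs.reverse.flatMap v ++ Y)
      (X ++ cs.reverse.flatMap q ++ Y) := by
  induction cs generalizing Y with
  | nil => simpa using Reach.refl _
  | cons c cs ih =>
    refine ((h c (cs.flatMap u ++ X ++ cs.reverse.flatMap v) Y).trans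
      ((ih (q c ++ Y)).cast rfl ?_ rfl)).cast ?_ ?_ ?_
    · simp
    · simp
      ring
    · simp
    · simp

/-- Iterate a gadget that merges `u c` on top with `v c` behind the part `X`, where the
merged pieces are appended to `X`. -/
theorem reach_iterate_append {k : ℕ} {u v q : ℤ → List ℤ}
    (h : ∀ c X Y, Reach k (u c ++ X ++ v c ++ Y) (X ++ q c ++ Y)) (cs X Y : List ℤ) :
    Reach (k * cs.length) (cs.flatMap u ++ X ++ cs.flatMap v ++ Y)
      (X ++ cs.flatMap q ++ Y) := by
  induction cs generalizing X with
  | nil => simpa using Reach.refl _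
  | cons c cs ih =>
    refine ((h c (cs.flatMap u ++ X) (cs.flatMap v ++ Y)).trans
      ((ih (X ++ q c)).cast rfl ?_ rfl)).cast ?_ ?_ ?_
    · simp
    · simp
      ring
    · simp
    · simp

theorem length_offsets (r : ℕ) : (offsets r).length = r := by
  simp [offsets]

theorem reach_cut (r : ℕ) (S S' : List ℤ) :
    Reach (4 * r) (expand (block r) (S ++ -100 :: S'))
      (expand (block r) (101 :: S ++ 102 :: S')) := by
  refine (reach_iterate_wrap reach_cut_octet (offsets r).reverse (expand (block r) S)
    (expand (block r) S')).cast ?_ ?_ ?_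
  · simp [length_offsets]
  · simp [expand_append, expand_cons, block, turn_flatMap, turn_cons, turn_nil, add_comm]
  · simp [expand_append, expand_cons, block]

theorem reach_exchange (r : ℕ) (S S' : List ℤ) :
    Reach (4 * r) (expand (block r) (-102 :: S ++ -101 :: S'))
      (expand (block r) (S ++ 103 :: S')) := by
  refine (reach_iterate_nested reach_exchange_octet (offsets r) (expand (block r) S)
    (expand (block r) S')).cast ?_ ?_ ?_
  · simp [length_offsets]
  · simp [expand_append, expand_cons, block, turn_flatMap, turn_cons, turn_nil, add_comm]
  · simp [expand_append, expand_cons, block]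

theorem reach_join_outer (r : ℕ) (S S' : List ℤ) :
    Reach (2 * r) (expand (block r) (S ++ 103 :: S'))
      (expand (block r) (104 :: S ++ 105 :: S')) := by
  refine (reach_iterate_wrap_reverse reach_join_octet_outer (offsets r) (expand (block r) S)
    (expand (block r) S')).cast ?_ ?_ ?_
  · simp [length_offsets]
  · simp [expand_append, expand_cons, block]
  · simp [expand_append, expand_cons, block]

theorem reach_join_inner (r : ℕ) (S S' : List ℤ) :
    Reach (2 * r) (expand (block r) (-105 :: S ++ -104 :: S'))
      (expand (block r) (S ++ 106 :: S')) := by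
  refine (reach_iterate_append reach_join_octet_inner (offsets r) (expand (block r) S)
    (expand (block r) S')).cast ?_ ?_ ?_
  · simp [length_offsets]
  · simp [expand_append, expand_cons, block, turn_flatMap, turn_cons, turn_nil, add_comm]
  · simp [expand_append, expand_cons, block]

theorem sortedStack_eq_map (n : ℕ) :
    sortedStack n = (List.range n).map fun i : ℕ => (i : ℤ) + 1 := by
  simp [sortedStack, ← List.map_eq_flatMap]

theorem burntStack_eq_map_neg (n : ℕ) : burntStack n = (sortedStack n).map Neg.neg := by
  simp [burntStack, sortedStack]

theorem sortedStack_add (a b : ℕ) :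
    sortedStack (a + b) = sortedStack a ++ (List.range b).map fun i : ℕ => (a : ℤ) + i + 1 := by
  simp [sortedStack_eq_map, List.range_add, Function.comp_def]

theorem sortedStack_octets (r : ℕ) :
    sortedStack (8 + 8 * r) = [1, 2, 3, 4, 5, 6, 7, 8] ++ block r 106 := by
  induction r with
  | zero => decide
  | succ r ih =>
    rw [show 8 + 8 * (r + 1) = 8 + 8 * r + 8 by ring, sortedStack_add, ih,
      show List.range 8 = [0, 1, 2, 3, 4, 5, 6, 7] from rfl]
    simp [block, offsets, List.range_succ]
    ring_nf
    simp

theorem block_of_lt (r : ℕ) {k : ℕ} (h : 8 < k) (h' : k < 100) :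
    block r k = [(k : ℤ) + 8 * r] := by
  unfold block
  split <;> first | omega | simp [h]

theorem sortedStack_eq_expand (r : ℕ) {q : ℕ} (hq : q ≤ 91) :
    sortedStack (8 + 8 * r + q) = expand (block r)
      ([1, 2, 3, 4, 5, 6, 7, 8] ++ 106 :: (List.range q).map fun i : ℕ => ((i + 9 : ℕ) : ℤ)) := by
  rw [sortedStack_add, sortedStack_octets]
  have h : expand (block r) ((List.range q).map fun i : ℕ => ((i + 9 : ℕ) : ℤ)) =
      (List.range q).map fun i : ℕ => ((8 + 8 * r : ℕ) : ℤ) + i + 1 := by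
    rw [expand, List.flatMap_map, List.map_eq_flatMap]
    refine List.flatMap_congr fun i hi => ?_
    have hi := List.mem_range.1 hi
    rw [if_pos (by omega), Int.natAbs_natCast, block_of_lt r (by omega) (by omega)]
    push_cast
    ring_nf
  rw [expand_append, expand_cons _ 106, h]
  simp [expand_cons, block]
  simp [expand]

theorem burntStack_eq_expand (r : ℕ) {q : ℕ} (hq : q ≤ 91) :
    burntStack (8 + 8 * r + q) = expand (block r) ([-1, -2, -3, -4, -5, -6, -7, -8] ++
      100 :: (List.range q).map fun i : ℕ => -((i + 9 : ℕ) : ℤ)) := by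
  rw [burntStack_eq_map_neg, sortedStack_add, sortedStack_octets]
  have h : expand (block r) ((List.range q).map fun i : ℕ => -((i + 9 : ℕ) : ℤ)) =
      (List.range q).map fun i : ℕ => -(((8 + 8 * r : ℕ) : ℤ) + i + 1) := by
    rw [expand, List.flatMap_map, List.map_eq_flatMap]
    refine List.flatMap_congr fun i hi => ?_
    have hi := List.mem_range.1 hi
    rw [if_neg (by omega), Int.natAbs_neg, Int.natAbs_natCast,
      block_of_lt r (by omega) (by omega), turn_cons, turn_nil, List.nil_append]
    push_cast
    ring_nf
  rw [expand_append, expand_cons _ 100, h]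
  simp [expand_cons, block, turn_cons, turn_nil, List.map_flatMap]
  simp [expand]

/-- The stack of size `21 + 8 * r` can be sorted in `33 + 12 * r` flips. -/
theorem reach_sorted_21 (r : ℕ) (hr : 1 ≤ r) :
    Reach (33 + 12 * r) (burntStack (21 + 8 * r)) (sortedStack (21 + 8 * r)) := by
  have h₀ := reach_expand hr [19, 16, 11, 21, 17, 8, 20, 15, 5, 8, 18, 22, 15, 9, 5, 12, 21]
      [-1, -2, -3, -4, -5, -6, -7, -8, 100, -9, -10, -11, -12, -13, -14, -15, -16, -17, -18, -19,
      -20, -21] [-6, -7, 12, 11, 10, 20, 21, 13, 14, 15, 9, -100, 8, -17, -16, 2, 1, -19, -18, 3,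
      4, 5] (by decide) (by decide) (by decide)
  have g₁ := reach_cut r [-6, -7, 12, 11, 10, 20, 21, 13, 14, 15, 9] [8, -17, -16, 2, 1, -19,
      -18, 3, 4, 5]
  have h₁ := reach_expand hr [4, 8, 23, 17, 7] [101, -6, -7, 12, 11, 10, 20, 21, 13, 14, 15,
      9, 102, 8, -17, -16, 2, 1, -19, -18, 3, 4, 5] [-102, -9, -15, -14, -13, -12, 7, 8, -17, -16,
      2, 1, -19, -18, 3, 4, 5, 6, -101, 11, 10, 20, 21] (by decide) (by decide) (by decide)
  have g₂ := reach_exchange r [-9, -15, -14, -13, -12, 7, 8, -17, -16, 2, 1, -19, -18, 3, 4,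
      5, 6] [11, 10, 20, 21]
  have h₂ := reach_expand hr [19, 14, 5, 8, 5] [-9, -15, -14, -13, -12, 7, 8, -17, -16, 2, 1,
      -19, -18, 3, 4, 5, 6, 103, 11, 10, 20, 21] [-8, -7, 1, -19, -18, -17, -16, 2, 3, 4, 5, 6,
      103, 11, 12, 13, 14, 15, 9, 10, 20, 21] (by decide) (by decide) (by decide)
  have g₃ := reach_join_outer r [-8, -7, 1, -19, -18, -17, -16, 2, 3, 4, 5, 6] [11, 12, 13,
      14, 15, 9, 10, 20, 21]
  have h₃ := reach_expand hr [19, 11, 15, 21, 12] [104, -8, -7, 1, -19, -18, -17, -16, 2, 3,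
      4, 5, 6, 105, 11, 12, 13, 14, 15, 9, 10, 20, 21] [-105, -6, -5, -4, -3, -2, -1, 7, 8, -104,
      9, 10, 11, 12, 13, 14, 15, 16, 17, 18, 19, 20, 21] (by decide) (by decide) (by decide)
  have g₄ := reach_join_inner r [-6, -5, -4, -3, -2, -1, 7, 8] [9, 10, 11, 12, 13, 14, 15, 16,
      17, 18, 19, 20, 21]
  have h₄ := reach_expand hr [6] [-6, -5, -4, -3, -2, -1, 7, 8, 106, 9, 10, 11, 12, 13, 14,
      15, 16, 17, 18, 19, 20, 21] [1, 2, 3, 4, 5, 6, 7, 8, 106, 9, 10, 11, 12, 13, 14, 15, 16, 17,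
      18, 19, 20, 21] (by decide) (by decide) (by decide)
  have h := (((h₀.trans g₁).trans h₁).trans g₂).trans h₂
  have h := (((h.trans g₃).trans h₃).trans g₄).trans h₄
  rw [show 21 + 8 * r = 8 + 8 * r + 13 by ring,
    burntStack_eq_expand r (by norm_num), sortedStack_eq_expand r (by norm_num)]
  exact h.cast (by simp; ring) (by rfl) (by rfl)

/-- The stack of size `33 + 8 * r` can be sorted in `51 + 12 * r` flips. -/
theorem reach_sorted_33 (r : ℕ) (hr : 1 ≤ r) :
    Reach (51 + 12 * r) (burntStack (33 + 8 * r)) (sortedStack (33 + 8 * r)) := by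
  have h₀ := reach_expand hr [31, 28, 11, 33, 29, 8, 32, 27, 5, 12, 16, 12, 14, 20, 30, 34,
      27, 21, 14, 8, 5, 24, 33] [-1, -2, -3, -4, -5, -6, -7, -8, 100, -9, -10, -11, -12, -13, -14,
      -15, -16, -17, -18, -19, -20, -21, -22, -23, -24, -25, -26, -27, -28, -29, -30, -31, -32,
      -33] [-6, -7, 12, 11, 10, 32, 33, 13, 14, 15, 9, -100, 8, -17, -16, -24, -25, -18, -19, -22,
      -23, -28, -29, -26, -27, -20, -21, 2, 1, -31, -30, 3, 4, 5] (by decide) (by decide) (by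
      decide)
  have g₁ := reach_cut r [-6, -7, 12, 11, 10, 32, 33, 13, 14, 15, 9] [8, -17, -16, -24, -25,
      -18, -19, -22, -23, -28, -29, -26, -27, -20, -21, 2, 1, -31, -30, 3, 4, 5]
  have h₁ := reach_expand hr [4, 8, 35, 29, 7] [101, -6, -7, 12, 11, 10, 32, 33, 13, 14, 15,
      9, 102, 8, -17, -16, -24, -25, -18, -19, -22, -23, -28, -29, -26, -27, -20, -21, 2, 1, -31,
      -30, 3, 4, 5] [-102, -9, -15, -14, -13, -12, 7, 8, -17, -16, -24, -25, -18, -19, -22, -23,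
      -28, -29, -26, -27, -20, -21, 2, 1, -31, -30, 3, 4, 5, 6, -101, 11, 10, 32, 33] (by decide)
      (by decide) (by decide)
  have g₂ := reach_exchange r [-9, -15, -14, -13, -12, 7, 8, -17, -16, -24, -25, -18, -19,
      -22, -23, -28, -29, -26, -27, -20, -21, 2, 1, -31, -30, 3, 4, 5, 6] [11, 10, 32, 33]
  have h₂ := reach_expand hr [31, 26, 17, 20, 14, 16, 10, 14, 18, 16, 9] [-9, -15, -14, -13,
      -12, 7, 8, -17, -16, -24, -25, -18, -19, -22, -23, -28, -29, -26, -27, -20, -21, 2, 1, -31,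
      -30, 3, 4, 5, 6, 103, 11, 10, 32, 33] [-8, -7, 1, -31, -30, -29, -26, -25, -18, -17, -16,
      -24, -23, -28, -27, -20, -19, -22, -21, 2, 3, 4, 5, 6, 103, 11, 12, 13, 14, 15, 9, 10, 32,
      33] (by decide) (by decide) (by decide)
  have g₃ := reach_join_outer r [-8, -7, 1, -31, -30, -29, -26, -25, -18, -17, -16, -24, -23,
      -28, -27, -20, -19, -22, -21, 2, 3, 4, 5, 6] [11, 12, 13, 14, 15, 9, 10, 32, 33]
  have h₃ := reach_expand hr [31, 19, 22, 16, 20, 24, 22, 16, 27, 33, 12] [104, -8, -7, 1,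
      -31, -30, -29, -26, -25, -18, -17, -16, -24, -23, -28, -27, -20, -19, -22, -21, 2, 3, 4, 5,
      6, 105, 11, 12, 13, 14, 15, 9, 10, 32, 33] [-105, -6, -5, -4, -3, -2, -1, 7, 8, -104, 9, 10,
      11, 12, 13, 14, 15, 16, 17, 18, 19, 20, 21, 22, 23, 24, 25, 26, 27, 28, 29, 30, 31, 32, 33]
      (by decide) (by decide) (by decide)
  have g₄ := reach_join_inner r [-6, -5, -4, -3, -2, -1, 7, 8] [9, 10, 11, 12, 13, 14, 15, 16,
      17, 18, 19, 20, 21, 22, 23, 24, 25, 26, 27, 28, 29, 30, 31, 32, 33]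
  have h₄ := reach_expand hr [6] [-6, -5, -4, -3, -2, -1, 7, 8, 106, 9, 10, 11, 12, 13, 14,
      15, 16, 17, 18, 19, 20, 21, 22, 23, 24, 25, 26, 27, 28, 29, 30, 31, 32, 33] [1, 2, 3, 4, 5,
      6, 7, 8, 106, 9, 10, 11, 12, 13, 14, 15, 16, 17, 18, 19, 20, 21, 22, 23, 24, 25, 26, 27, 28,
      29, 30, 31, 32, 33] (by decide) (by decide) (by decide)
  have h := (((h₀.trans g₁).trans h₁).trans g₂).trans h₂
  have h := (((h.trans g₃).trans h₃).trans g₄).trans h₄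
  rw [show 33 + 8 * r = 8 + 8 * r + 25 by ring,
    burntStack_eq_expand r (by norm_num), sortedStack_eq_expand r (by norm_num)]
  exact h.cast (by simp; ring) (by rfl) (by rfl)

/-- For every integer `n ≥ 29` with `n ≡ 5 (mod 12)`, there exists a sequence of flips of
length exactly `(3n+3)/2` transforming `Ī_n` into `I_n`. -/
theorem exists_sorting_seq_five_mod_twelve (n : ℕ) (hn : 29 ≤ n) (hmod : n % 12 = 5) :
    ∃ ks : List ℕ, IsSortingSeq n ks ∧ ks.length = (3 * n + 3) / 2 := by
  obtain ⟨m, hm⟩ : ∃ m, n = 12 * m + 29 := ⟨(n - 29) / 12, by omega⟩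
  obtain ⟨ks, hl, hk, hs⟩ : Reach ((3 * n + 3) / 2) (burntStack n) (sortedStack n) := by
    rcases Nat.even_or_odd' m with ⟨k, rfl | rfl⟩
    · have h := reach_sorted_21 (3 * k + 1) (by omega)
      rw [show 21 + 8 * (3 * k + 1) = n by omega] at h
      exact h.cast (by omega) rfl rfl
    · have h := reach_sorted_33 (3 * k + 1) (by omega)
      rw [show 33 + 8 * (3 * k + 1) = n by omega] at h
      exact h.cast (by omega) rfl rfl
  refine ⟨ks, ⟨fun k h => ?_, hs⟩, hl⟩
  simpa [burntStack_eq_map_neg, sortedStack_eq_map] using hk k h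
end

section
/- For every even integer n ≥ 14, the minimum number of flips T(n) needed to sort the burnt stack Ī_n = [-1, -2, ..., -n] into I_n = [1, 2, ..., n] satisfies T(n) = 3n/2 + 1 or T(n) = 3n/2 + 2. -/
namespace PancakeSorting

/-- Turn a block of pancakes upside down. -/
def negRev (l : List ℤ) : List ℤ := (l.map Neg.neg).reverse

@[simp] lemma negRev_nil : negRev [] = [] := rfl

@[simp] lemma negRev_append (A B : List ℤ) : negRev (A ++ B) = negRev B ++ negRev A := by
  simp [negRev]

@[simp] lemma negRev_cons (a : ℤ) (B : List ℤ) : negRev (a :: B) = negRev B ++ [-a] := by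
  simp [negRev]

@[simp] lemma negRev_negRev (A : List ℤ) : negRev (negRev A) = A := by
  simp [negRev]

@[simp] lemma length_negRev (A : List ℤ) : (negRev A).length = A.length := by
  simp [negRev]

lemma pancakeFlip_eq (k : ℕ) (l : List ℤ) :
    pancakeFlip k l = negRev (l.take k) ++ l.drop k := rfl

@[simp] lemma length_pancakeFlip (k : ℕ) (l : List ℤ) :
    (pancakeFlip k l).length = l.length := by
  simp [pancakeFlip_eq]; omega

lemma pancakeFlip_append (A B : List ℤ) :
    pancakeFlip A.length (A ++ B) = negRev A ++ B := by
  simp [pancakeFlip_eq]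

lemma pancakeFlip_involutive (k : ℕ) (l : List ℤ) : pancakeFlip k (pancakeFlip k l) = l := by
  obtain ⟨A, B, rfl, h⟩ : ∃ A B, l = A ++ B ∧ (A.length = k ∨ (A.length ≤ k ∧ B = [])) := by
    refine ⟨l.take k, l.drop k, by simp, ?_⟩
    by_cases h : k ≤ l.length
    · left; simp [h]
    · right; simp; omega
  rcases h with rfl | ⟨h, rfl⟩
  · rw [pancakeFlip_append]
    conv_lhs => rw [← length_negRev, pancakeFlip_append]
    simp
  · have hA : ∀ B : List ℤ, B.length ≤ k → pancakeFlip k B = negRev B := fun B hB => by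
      rw [pancakeFlip_eq, List.take_of_length_le hB, List.drop_eq_nil_of_le hB, List.append_nil]
    rw [List.append_nil, hA A h, hA _ (by simpa using h), negRev_negRev]

/-- `Reach m l l'` says that some sequence of `m` flips transforms `l` into `l'`. -/
def Reach (m : ℕ) (l l' : List ℤ) : Prop :=
  ∃ ks : List ℕ, ks.length = m ∧ applyFlips ks l = l'

lemma Reach.refl (l : List ℤ) : Reach 0 l l := ⟨[], rfl, rfl⟩

lemma applyFlips_append (ks ks' : List ℕ) (l : List ℤ) :
    applyFlips (ks ++ ks') l = applyFlips ks' (applyFlips ks l) := by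
  simp [applyFlips]

lemma Reach.trans {m m' : ℕ} {l₁ l₂ l₃ : List ℤ} (h : Reach m l₁ l₂) (h' : Reach m' l₂ l₃) :
    Reach (m + m') l₁ l₃ := by
  obtain ⟨ks, rfl, rfl⟩ := h
  obtain ⟨ks', rfl, rfl⟩ := h'
  exact ⟨ks ++ ks', by simp, applyFlips_append _ _ _⟩

lemma Reach.flip (A B : List ℤ) : Reach 1 (A ++ B) (negRev A ++ B) :=
  ⟨[A.length], rfl, pancakeFlip_append A B⟩

lemma Reach.flip' {l l' : List ℤ} (A B : List ℤ) (h : l = A ++ B) (h' : negRev A ++ B = l') :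
    Reach 1 l l' := by
  subst h h'; exact Reach.flip A B

lemma applyFlips_reverse (ks : List ℕ) (l : List ℤ) :
    applyFlips ks.reverse (applyFlips ks l) = l := by
  induction ks generalizing l with
  | nil => rfl
  | cons k ks ih =>
    rw [List.reverse_cons, applyFlips_append]
    change pancakeFlip k (applyFlips ks.reverse (applyFlips ks (pancakeFlip k l))) = l
    rw [ih, pancakeFlip_involutive]

lemma Reach.symm {m : ℕ} {l l' : List ℤ} (h : Reach m l l') : Reach m l' l := by
  obtain ⟨ks, rfl, rfl⟩ := h
  exact ⟨ks.reverse, by simp, applyFlips_reverse ks l⟩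

lemma negRev_flatMap {ρ : ℤ → List ℤ} (hρ : ∀ z, ρ (-z) = negRev (ρ z)) (A : List ℤ) :
    (negRev A).flatMap ρ = negRev (A.flatMap ρ) := by
  induction A with
  | nil => rfl
  | cons a A ih => simp [ih, hρ]

/-- A flip of a stack of blocks is a flip of the stack obtained by concatenating the blocks. -/
lemma Reach.flatMap {ρ : ℤ → List ℤ} (hρ : ∀ z, ρ (-z) = negRev (ρ z)) {m : ℕ} {l l' : List ℤ}
    (h : Reach m l l') : Reach m (l.flatMap ρ) (l'.flatMap ρ) := by
  obtain ⟨ks, rfl, rfl⟩ := h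
  induction ks generalizing l with
  | nil => exact Reach.refl _
  | cons k ks ih =>
    rw [List.length_cons, add_comm]
    refine Reach.trans (Reach.flip' ((l.take k).flatMap ρ) ((l.drop k).flatMap ρ) ?_ ?_)
      (ih (l := pancakeFlip k l))
    · rw [← List.flatMap_append, List.take_append_drop]
    · rw [pancakeFlip_eq, List.flatMap_append, negRev_flatMap hρ]

/-- The interpretation of a signed block name, given the blocks. -/
def signedBlock (f : ℕ → List ℤ) (z : ℤ) : List ℤ :=
  if 0 < z then f z.natAbs else if z < 0 then negRev (f z.natAbs) else []

lemma signedBlock_neg (f : ℕ → List ℤ) (z : ℤ) :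
    signedBlock f (-z) = negRev (signedBlock f z) := by
  unfold signedBlock
  rcases lt_trichotomy z 0 with h | rfl | h
  · simp [h, not_lt.2 h.le]
  · simp
  · simp [h, not_lt.2 h.le]

/-- The stack obtained from a stack of signed block names. -/
def expand (f : ℕ → List ℤ) (l : List ℤ) : List ℤ := l.flatMap (signedBlock f)

lemma Reach.blocks (f : ℕ → List ℤ) {l l' : List ℤ} (ks : List ℕ) (h : applyFlips ks l = l')
    {L L' : List ℤ} (hL : L = expand f l) (hL' : L' = expand f l') :
    Reach ks.length L L' := by
  subst hL hL'
  exact Reach.flatMap (signedBlock_neg f) ⟨ks, rfl, h⟩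

/-- The concatenation of the pairs `a i, b i` for `i < j`. -/
def pairs (a b : ℕ → ℤ) (j : ℕ) : List ℤ := (List.range j).flatMap fun i => [a i, b i]

/-- The concatenation of the quadruples `a i, b i, c i, d i` for `i < j`. -/
def quads (a b c d : ℕ → ℤ) (j : ℕ) : List ℤ :=
  (List.range j).flatMap fun i => [a i, b i, c i, d i]

@[simp] lemma pairs_zero (a b : ℕ → ℤ) : pairs a b 0 = [] := rfl

@[simp] lemma quads_zero (a b c d : ℕ → ℤ) : quads a b c d 0 = [] := rfl

lemma pairs_succ (a b : ℕ → ℤ) (j : ℕ) :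
    pairs a b (j + 1) = a 0 :: b 0 :: pairs (fun i => a (i + 1)) (fun i => b (i + 1)) j := by
  simp [pairs, List.range_succ_eq_map, List.flatMap_map]

lemma pairs_succ' (a b : ℕ → ℤ) (j : ℕ) : pairs a b (j + 1) = pairs a b j ++ [a j, b j] := by
  simp [pairs, List.range_succ]

lemma quads_succ (a b c d : ℕ → ℤ) (j : ℕ) :
    quads a b c d (j + 1) = a 0 :: b 0 :: c 0 :: d 0 ::
      quads (fun i => a (i + 1)) (fun i => b (i + 1)) (fun i => c (i + 1)) (fun i => d (i + 1))
        j := by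
  simp [quads, List.range_succ_eq_map, List.flatMap_map]

lemma quads_succ' (a b c d : ℕ → ℤ) (j : ℕ) :
    quads a b c d (j + 1) = quads a b c d j ++ [a j, b j, c j, d j] := by
  simp [quads, List.range_succ]

lemma quads_congr {a b c d a' b' c' d' : ℕ → ℤ} {j : ℕ} (ha : ∀ i < j, a i = a' i)
    (hb : ∀ i < j, b i = b' i) (hc : ∀ i < j, c i = c' i) (hd : ∀ i < j, d i = d' i) :
    quads a b c d j = quads a' b' c' d' j := by
  unfold quads
  apply List.flatMap_congr
  intro i hi
  have := List.mem_range.1 hi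
  simp [*]

lemma negRev_quads (a b c d : ℕ → ℤ) (j : ℕ) :
    negRev (quads a b c d j) = quads (fun i => -d (j - 1 - i)) (fun i => -c (j - 1 - i))
      (fun i => -b (j - 1 - i)) (fun i => -a (j - 1 - i)) j := by
  induction j with
  | zero => rfl
  | succ j ih =>
    rw [quads_succ', quads_succ, negRev_append, ih]
    simp only [negRev_cons, negRev_nil, List.nil_append, List.cons_append,
      Nat.add_sub_cancel, Nat.sub_zero]
    congr 4
    apply quads_congr <;> intro i _ <;> congr 2 <;> omega

/-- A regrouping of quadruples after cutting off the last entry. -/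
lemma quads_rotate (a b c d : ℕ → ℤ) (j : ℕ) :
    quads b c d a j ++ [b j] = b 0 :: quads c d a (fun i => b (i + 1)) j := by
  induction j with
  | zero => rfl
  | succ j ih =>
    rw [quads_succ', quads_succ', ← List.cons_append, ← ih]
    simp

/-- Interleaving two sequences of pairs, turning those of the first one upside down. -/
lemma Reach.riffle (x x' y y' : ℕ → ℤ) (j : ℕ) (M R : List ℤ) :
    Reach (2 * j) (pairs x x' j ++ M ++ pairs y y' j ++ R)
      (M ++ quads y y' (fun i => -x' i) (fun i => -x i) j ++ R) := by
  induction j generalizing x x' y y' M with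
  | zero => simpa using Reach.refl (M ++ R)
  | succ j ih =>
    have h := ih (fun i => x (i + 1)) (fun i => x' (i + 1)) (fun i => y (i + 1))
      (fun i => y' (i + 1)) (M ++ [y 0, y' 0, -x' 0, -x 0])
    set X := pairs (fun i => x (i + 1)) (fun i => x' (i + 1)) j with hX
    set Y := pairs (fun i => y (i + 1)) (fun i => y' (i + 1)) j with hY
    rw [show 2 * (j + 1) = 1 + (1 + 2 * j) by ring]
    refine Reach.trans (Reach.flip' ([x 0, x' 0] ++ X ++ M ++ [y 0, y' 0]) (Y ++ R)
      (by simp [pairs_succ, hX, hY]) rfl) (Reach.trans (Reach.flip'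
        (negRev (X ++ M ++ [y 0, y' 0])) ([-x' 0, -x 0] ++ Y ++ R) (by simp) rfl) ?_)
    convert h using 1 <;> simp [quads_succ]

lemma Reach.riffle' (x x' y y' : ℕ → ℤ) (j : ℕ) (M R : List ℤ) :
    Reach (2 * j) (pairs x x' j ++ M ++ pairs y y' j ++ R)
      (M ++ quads (fun i => -x' i) (fun i => -x i) y y' j ++ R) := by
  induction j generalizing x x' y y' M with
  | zero => simpa using Reach.refl (M ++ R)
  | succ j ih =>
    have h := ih (fun i => x (i + 1)) (fun i => x' (i + 1)) (fun i => y (i + 1))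
      (fun i => y' (i + 1)) (M ++ [-x' 0, -x 0, y 0, y' 0])
    set X := pairs (fun i => x (i + 1)) (fun i => x' (i + 1)) j with hX
    set Y := pairs (fun i => y (i + 1)) (fun i => y' (i + 1)) j with hY
    rw [show 2 * (j + 1) = 1 + (1 + 2 * j) by ring]
    refine Reach.trans (Reach.flip' ([x 0, x' 0] ++ X ++ M) ([y 0, y' 0] ++ Y ++ R)
      (by simp [pairs_succ, hX, hY]) rfl) (Reach.trans (Reach.flip'
        (negRev (X ++ M)) ([-x' 0, -x 0] ++ [y 0, y' 0] ++ Y ++ R) (by simp) rfl) ?_)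
    convert h using 1 <;> simp [quads_succ]

/-- Conjugating the flip of a long initial block by flips whose sizes increase in steps of
four. -/
lemma Reach.shift (a b c d : ℕ → ℤ) (j m : ℕ) (A R R' : List ℤ)
    (h : ∀ B : List ℤ, B.length = A.length + 4 * j →
      Reach m (B ++ d j :: R) (negRev B ++ R')) :
    Reach (2 * j + m) (A ++ [d 0] ++ quads a b c (fun i => d (i + 1)) j ++ R)
      (negRev A ++ quads b c d a j ++ R') := by
  induction j generalizing a b c d A with
  | zero => simpa using h A (by simp)
  | succ j ih =>
    have h' := ih (fun i => a (i + 1)) (fun i => b (i + 1)) (fun i => c (i + 1))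
      (fun i => d (i + 1)) ([-a 0, -d 0] ++ negRev A ++ [b 0, c 0])
      (fun B hB => h B (by simp [hB]; ring))
    rw [show 2 * (j + 1) + m = 1 + (2 * j + m) + 1 by ring]
    refine Reach.trans (Reach.trans (Reach.flip' (A ++ [d 0, a 0])
      ([b 0, c 0] ++ [d 1] ++ quads (fun i => a (i + 1)) (fun i => b (i + 1))
        (fun i => c (i + 1)) (fun i => d (i + 1 + 1)) j ++ R) (by simp [quads_succ]) rfl)
      (by simpa using h'))
      (Reach.flip' ([-c 0, -b 0] ++ A) ([d 0, a 0] ++ quads (fun i => b (i + 1))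
        (fun i => c (i + 1)) (fun i => d (i + 1)) (fun i => a (i + 1)) j ++ R')
        (by simp) (by simp [quads_succ]))

/-- The block `a + 1, a + 2, …, a + m`. -/
def run (a m : ℕ) : List ℤ := (List.range m).map fun i => ((a + i + 1 : ℕ) : ℤ)

lemma run_add (a m m' : ℕ) : run a (m + m') = run a m ++ run (a + m) m' := by
  simp [run, List.range_add, Function.comp_def, add_assoc]

lemma run_one (a : ℕ) : run a 1 = [((a + 1 : ℕ) : ℤ)] := rfl

lemma run_succ (a m : ℕ) : run a (m + 1) = ((a + 1 : ℕ) : ℤ) :: run (a + 1) m := by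
  rw [add_comm, run_add]; rfl

@[simp] lemma run_zero (a : ℕ) : run a 0 = [] := rfl

@[simp] lemma length_run (a m : ℕ) : (run a m).length = m := by simp [run]

lemma run_two_mul (a j : ℕ) :
    run a (2 * j) = pairs (fun i => a + 2 * i + 1) (fun i => a + 2 * i + 2) j := by
  induction j with
  | zero => rfl
  | succ j ih =>
    rw [Nat.mul_succ, run_add, ih, pairs_succ']
    simp [run, List.range_succ, add_assoc]

lemma sortedStack_eq_run (n : ℕ) : sortedStack n = run 0 n := by
  have h : (List.range n).flatMap (fun a : ℕ => [(a : ℤ)]) = (List.range n).map Nat.cast :=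
    (List.map_eq_flatMap ..).symm
  simp [sortedStack, run, h]

lemma burntStack_eq_run (n : ℕ) : burntStack n = (run 0 n).map Neg.neg := by
  have h : (List.range n).flatMap (fun a : ℕ => [(a : ℤ)]) = (List.range n).map Nat.cast :=
    (List.map_eq_flatMap ..).symm
  simp [burntStack, run, h, Function.comp_def]

lemma map_neg_pairs (a b : ℕ → ℤ) (j : ℕ) :
    (pairs a b j).map Neg.neg = pairs (fun i => -a i) (fun i => -b i) j := by
  simp [pairs, List.map_flatMap]

/-- A stack of size `21 + 4 * j` one flip away from the reversed burnt stack. -/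
lemma reach_of_mod_four_eq_one (j : ℕ) :
    Reach (6 * j + 32) (sortedStack (21 + 4 * j))
      (negRev ((run 0 (2 * j + 10)).map Neg.neg) ++
        (run (2 * j + 10) (2 * j + 11)).map Neg.neg) := by
  set block : ℕ → List ℤ := fun k =>
    if k ≤ 10 then [((2 * j + k : ℕ) : ℤ)] else [((4 * j + k : ℕ) : ℤ)] with hblock
  set Z : List ℤ := quads (fun i => (2 * j + 11 + 2 * i : ℤ)) (fun i => 2 * j + 12 + 2 * i)
    (fun i => (-(2 * i + 2) : ℤ)) (fun i => (-(2 * i + 1) : ℤ)) j with hZ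
  set W : List ℤ := (2 * j + 11 : ℤ) :: quads (fun i => (-(2 * i + 1) : ℤ))
    (fun i => 2 * j + 13 + 2 * i) (fun i => 2 * j + 12 + 2 * i) (fun i => (-(2 * i + 2) : ℤ)) j
    with hW
  set U : List ℤ := (run (2 * j + 11) (2 * j)).map Neg.neg with hU
  set V : List ℤ := (run 1 (2 * j)).map Neg.neg with hV
  set f : ℕ → List ℤ := fun k => if k = 22 then Z else block k with hf
  set g : ℕ → List ℤ := fun k => if k = 22 then W else block k with hg
  set p : ℕ → List ℤ := fun k =>
    if k = 25 then V else if k = 24 then U else if k = 23 then [-1] else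
      if k = 22 then [(2 * j + 11 : ℤ)] else block k with hp
  have h₁ : Reach (2 * j) (sortedStack (21 + 4 * j)) (run (2 * j) 10 ++ Z ++ run (4 * j + 10) 11)
    := by
    have h := Reach.riffle (fun i => (0 : ℕ) + 2 * i + 1) (fun i => (0 : ℕ) + 2 * i + 2)
      (fun i => ((2 * j + 10 : ℕ) : ℤ) + 2 * i + 1) (fun i => ((2 * j + 10 : ℕ) : ℤ) + 2 * i + 2) j
      (run (2 * j) 10) (run (4 * j + 10) 11)
    convert h using 1
    · rw [← run_two_mul, ← run_two_mul, sortedStack_eq_run,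
        show 21 + 4 * j = 2 * j + 10 + 2 * j + 11 by ring, run_add, run_add, run_add]
      simp only [zero_add, show 2 * j + 10 + 2 * j = 4 * j + 10 by ring]
    · rw [hZ]
      congr 2
      apply quads_congr <;> intro i _ <;> push_cast <;> ring
  have h₂ : Reach 6 (run (2 * j) 10 ++ Z ++ run (4 * j + 10) 11)
      (expand f [-1, 5, 6, 7, -16, -15, -14, 17, 18, -13, -12, -11, -22, -10, -9, -8, 2, 3, 4, 19,
        20, 21]) := by
    refine Reach.blocks f [4, 19, 5, 3, 12, 16]
      (l := [1, 2, 3, 4, 5, 6, 7, 8, 9, 10, 22, 11, 12, 13, 14, 15, 16, 17, 18, 19, 20, 21])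
      (by decide) ?_ rfl
    simp [expand, signedBlock, hf, hblock, run, List.range_succ]
    norm_num [add_assoc]
  have h₃ : Reach (2 * j + 1)
      (expand f [-1, 5, 6, 7, -16, -15, -14, 17, 18, -13, -12, -11, -22, -10, -9, -8, 2, 3, 4, 19,
        20, 21])
      (expand g [12, 13, -18, -17, 14, 15, 16, -7, -6, -5, 1, -22, -10, -9, -8, 2, 3, 4, 19, 20,
        21]) := by
    have h := Reach.shift (fun i => (2 * j - 1 - 2 * i : ℤ)) (fun i => (2 * j - 2 * i : ℤ))
      (fun i => (-(4 * j + 10 - 2 * i) : ℤ)) (fun i => (-(4 * j + 11 - 2 * i) : ℤ)) j 1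
      (expand block [-1, 5, 6, 7, -16, -15, -14, 17, 18, -13, -12])
      (expand block [-10, -9, -8, 2, 3, 4, 19, 20, 21])
      ((-(4 * j + 11 - 2 * j) : ℤ) :: expand block [-10, -9, -8, 2, 3, 4, 19, 20, 21])
      (fun B _ => Reach.flip B _)
    convert h using 1
    · simp [expand, signedBlock, hf, hblock, hZ, negRev_quads]
      apply quads_congr <;> intro i hi <;> omega
    · simp [expand, signedBlock, hg, hblock, hW, negRev_quads]
      congr 1
      · apply quads_congr <;> intro i hi <;> omega
      · congr 1
        ring
  have h₄ : Reach 15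
      (expand g [12, 13, -18, -17, 14, 15, 16, -7, -6, -5, 1, -22, -10, -9, -8, 2, 3, 4, 19, 20,
        21])
      (expand g [-12, 20, 21, 10, 22, -1, -2, -3, 9, 8, 7, 6, -15, -16, -17, 14, 13, -18, -19, -4,
        -5]) :=
    Reach.blocks _ [19, 16, 3, 5, 11, 13, 9, 21, 9, 13, 11, 20, 5, 3, 16] (by decide) rfl rfl
  have h₅ : Reach (2 * j)
      (expand p [24, -12, 20, 21, 10, 22, 23, 25, -2, -3, 9, 8, 7, 6, -15, -16, -17, 14, 13, -18,
        -19, -4, -5])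
      (expand g [-12, 20, 21, 10, 22, -1, -2, -3, 9, 8, 7, 6, -15, -16, -17, 14, 13, -18, -19, -4,
        -5]) := by
    have hW' : W ++ [(-(2 * j + 1) : ℤ)] = [(2 * j + 11 : ℤ), -1] ++
        quads (fun i => -(-(2 * j + 13 + 2 * i) : ℤ)) (fun i => -(-(2 * j + 12 + 2 * i) : ℤ))
          (fun i => (-(2 * i + 2) : ℤ)) (fun i => (-(2 * i + 3) : ℤ)) j := by
      rw [hW, List.cons_append, quads_rotate]
      simp only [neg_neg, List.cons_append, List.nil_append]
      congr 2
    have hU' : U = pairs (fun i => (-(2 * j + 12 + 2 * i) : ℤ))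
        (fun i => (-(2 * j + 13 + 2 * i) : ℤ)) j := by
      rw [hU, run_two_mul, map_neg_pairs]
      congr 1 <;> funext i <;> push_cast <;> ring
    have hV' : V = pairs (fun i => (-(2 * i + 2) : ℤ)) (fun i => (-(2 * i + 3) : ℤ)) j := by
      rw [hV, run_two_mul, map_neg_pairs]
      congr 1 <;> funext i <;> push_cast <;> ring
    have h := Reach.riffle' (fun i => (-(2 * j + 12 + 2 * i) : ℤ))
      (fun i => (-(2 * j + 13 + 2 * i) : ℤ)) (fun i => (-(2 * i + 2) : ℤ))
      (fun i => (-(2 * i + 3) : ℤ)) j (expand block [-12, 20, 21, 10] ++ [(2 * j + 11 : ℤ), -1])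
      (expand block [-2, -3, 9, 8, 7, 6, -15, -16, -17, 14, 13, -18, -19, -4, -5])
    rw [List.append_assoc (expand _ _) _ (quads _ _ _ _ _), ← hW', ← hU', ← hV'] at h
    clear_value U V W
    convert h using 1 <;> simp [expand, signedBlock, hg, hp, hblock]
  have h₆ : Reach 10
      (expand p [24, -12, 20, 21, 10, 22, 23, 25, -2, -3, 9, 8, 7, 6, -15, -16, -17, 14, 13, -18,
        -19, -4, -5])
      (negRev ((run 0 (2 * j + 10)).map Neg.neg) ++
        (run (2 * j + 10) (2 * j + 11)).map Neg.neg) := by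
    refine Reach.blocks _ [5, 10, 21, 13, 23, 17, 3, 5, 8, 22] (l' := [10, 9, 8, 7, 6, 5, 4, 3, 2,
      -25, -23, -22, 24, -12, -13, -14, -15, -16, -17, -18, -19, -20, -21]) (by decide) rfl ?_
    rw [show 2 * j + 10 = 1 + 2 * j + 9 by ring, run_add, run_add,
      show 2 * j + 11 = 1 + 2 * j + 10 by ring, run_add, run_add,
      show 1 + 2 * j + 9 + 1 = 2 * j + 11 by ring]
    simp only [List.map_append, negRev_append, zero_add, ← hU, ← hV]
    clear_value U V
    simp [expand, signedBlock, hp, hblock, run, List.range_succ]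
    omega
  have h := ((((h₁.trans h₂).trans h₃).trans h₄).trans h₅.symm).trans h₆
  convert h using 1
  ring

/-- A stack of size `15 + 4 * j` one flip away from the reversed burnt stack. -/
lemma reach_of_mod_four_eq_three (j : ℕ) :
    Reach (6 * j + 23) (sortedStack (15 + 4 * j))
      (negRev ((run 0 (2 * j + 6)).map Neg.neg) ++ (run (2 * j + 6) (2 * j + 9)).map Neg.neg) := by
  set block : ℕ → List ℤ := fun k =>
    if k ≤ 9 then [((2 * j + k : ℕ) : ℤ)] else [((4 * j + k : ℕ) : ℤ)] with hblock
  set Z : List ℤ := quads (fun i => (-(2 * i + 2) : ℤ)) (fun i => (-(2 * i + 1) : ℤ))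
    (fun i => (2 * j + 10 + 2 * i : ℤ)) (fun i => (2 * j + 11 + 2 * i : ℤ)) j with hZ
  set W : List ℤ := quads (fun i => (-(2 * i + 1) : ℤ)) (fun i => (2 * j + 10 + 2 * i : ℤ))
    (fun i => (2 * j + 9 + 2 * i : ℤ)) (fun i => (-(2 * i + 2) : ℤ)) j with hW
  set U : List ℤ := (run (2 * j + 8) (2 * j)).map Neg.neg with hU
  set V : List ℤ := (run 1 (2 * j)).map Neg.neg with hV
  set f : ℕ → List ℤ := fun k => if k = 16 then Z else block k with hf
  set g : ℕ → List ℤ := fun k =>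
    if k = 17 then [(4 * j + 9 : ℤ)] else if k = 16 then W else block k with hg
  set p : ℕ → List ℤ := fun k =>
    if k = 19 then V else if k = 18 then U else if k = 16 then [1] else
      if k = 17 then [(4 * j + 9 : ℤ)] else block k with hp
  have h₁ : Reach (2 * j) (sortedStack (15 + 4 * j))
      (run (2 * j) 9 ++ Z ++ run (4 * j + 9) 6) := by
    have h := Reach.riffle' (fun i => (0 : ℕ) + 2 * i + 1) (fun i => (0 : ℕ) + 2 * i + 2)
      (fun i => ((2 * j + 9 : ℕ) : ℤ) + 2 * i + 1) (fun i => ((2 * j + 9 : ℕ) : ℤ) + 2 * i + 2) j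
      (run (2 * j) 9) (run (4 * j + 9) 6)
    convert h using 1
    · rw [← run_two_mul, ← run_two_mul, sortedStack_eq_run,
        show 15 + 4 * j = 2 * j + 9 + 2 * j + 6 by ring, run_add, run_add, run_add]
      simp only [zero_add, show 2 * j + 9 + 2 * j = 4 * j + 9 by ring]
    · rw [hZ]
      congr 2
      apply quads_congr <;> intro i _ <;> push_cast <;> ring
  have h₂ : Reach 9 (run (2 * j) 9 ++ Z ++ run (4 * j + 9) 6)
      (expand f [-7, -6, -15, -14, 8, 9, 16, -13, -12, -3, -2, -1, 5, 4, 11, 10]) := by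
    refine Reach.blocks f [4, 11, 16, 10, 4, 6, 15, 7, 4]
      (l := [1, 2, 3, 4, 5, 6, 7, 8, 9, 16, 10, 11, 12, 13, 14, 15]) (by decide) ?_ rfl
    simp [expand, signedBlock, hf, hblock, run, List.range_succ]
    norm_num [add_assoc]
  have h₃ : Reach (2 * j + 3)
      (expand f [-7, -6, -15, -14, 8, 9, 16, -13, -12, -3, -2, -1, 5, 4, 11, 10])
      (expand g [-8, 14, 15, 6, 7, 16, -1, 5, 4, 11, 10, 17, -13, -12, -3, -2]) := by
    have h := Reach.shift (fun i => (-(2 * i + 2) : ℤ)) (fun i => (-(2 * i + 1) : ℤ))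
      (fun i => (2 * j + 10 + 2 * i : ℤ)) (fun i => (2 * j + 9 + 2 * i : ℤ)) j 3
      (expand block [-7, -6, -15, -14, 8])
      (expand block [-13, -12, -3, -2, -1, 5, 4, 11, 10])
      (expand block [-1, 5, 4, 11, 10] ++ [(2 * j + 9 + 2 * j : ℤ)] ++
        expand block [-13, -12, -3, -2])
      (fun B _ => Reach.blocks (fun k => if k = 18 then B else if k = 17 then
          [(2 * j + 9 + 2 * j : ℤ)] else block k) [6, 11, 6]
        (l := [18, 17, -13, -12, -3, -2, -1, 5, 4, 11, 10])
        (l' := [-18, -1, 5, 4, 11, 10, 17, -13, -12, -3, -2]) (by decide)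
        (by simp [expand, signedBlock, hblock]) (by simp [expand, signedBlock, hblock]))
    convert h using 1
    · simp [expand, signedBlock, hf, hblock, hZ]
      apply quads_congr <;> intro i hi <;> ring
    · simp [expand, signedBlock, hg, hblock, hW]
      ring
  have h₄ : Reach 9 (expand g [-8, 14, 15, 6, 7, 16, -1, 5, 4, 11, 10, 17, -13, -12, -3, -2])
      (expand g [-17, -10, -11, -12, -13, -14, 8, 7, 16, -1, -2, -3, -4, -5, -6, -15]) :=
    Reach.blocks _ [4, 7, 15, 6, 4, 10, 16, 11, 4] (by decide) rfl rfl
  have h₅ : Reach (2 * j)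
      (expand p [18, -17, -10, -11, -12, -13, -14, 8, 7, -16, 19, -2, -3, -4, -5, -6, -15])
      (expand g [-17, -10, -11, -12, -13, -14, 8, 7, 16, -1, -2, -3, -4, -5, -6, -15]) := by
    have hW' : W ++ [(-(2 * j + 1) : ℤ)] = [-1] ++
        quads (fun i => -(-(2 * j + 10 + 2 * i) : ℤ)) (fun i => -(-(2 * j + 9 + 2 * i) : ℤ))
          (fun i => (-(2 * i + 2) : ℤ)) (fun i => (-(2 * i + 3) : ℤ)) j := by
      rw [hW, quads_rotate]
      simp only [neg_neg, List.cons_append, List.nil_append]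
      congr 2
    have hU' : U = pairs (fun i => (-(2 * j + 9 + 2 * i) : ℤ))
        (fun i => (-(2 * j + 10 + 2 * i) : ℤ)) j := by
      rw [hU, run_two_mul, map_neg_pairs]
      congr 1 <;> funext i <;> push_cast <;> ring
    have hV' : V = pairs (fun i => (-(2 * i + 2) : ℤ)) (fun i => (-(2 * i + 3) : ℤ)) j := by
      rw [hV, run_two_mul, map_neg_pairs]
      congr 1 <;> funext i <;> push_cast <;> ring
    have h := Reach.riffle' (fun i => (-(2 * j + 9 + 2 * i) : ℤ))
      (fun i => (-(2 * j + 10 + 2 * i) : ℤ)) (fun i => (-(2 * i + 2) : ℤ))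
      (fun i => (-(2 * i + 3) : ℤ)) j
      (expand p [-17, -10, -11, -12, -13, -14, 8, 7] ++ [-1])
      (expand block [-2, -3, -4, -5, -6, -15])
    rw [List.append_assoc (expand _ _) _ (quads _ _ _ _ _), ← hW', ← hU', ← hV'] at h
    clear_value U V W
    convert h using 1 <;> simp [expand, signedBlock, hg, hp, hblock]
  have h₆ : Reach 2
      (expand p [18, -17, -10, -11, -12, -13, -14, 8, 7, -16, 19, -2, -3, -4, -5, -6, -15])
      (negRev ((run 0 (2 * j + 6)).map Neg.neg) ++
        (run (2 * j + 6) (2 * j + 9)).map Neg.neg) := by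
    refine Reach.blocks _ [7, 16] (l' := [6, 5, 4, 3, 2, -19, 16, -7, -8, 18, -17, -10, -11, -12,
      -13, -14, -15]) (by decide) rfl ?_
    rw [show 2 * j + 6 = 1 + 2 * j + 5 by ring, run_add, run_add,
      show 2 * j + 9 = 2 + 2 * j + 7 by ring, run_add, run_add,
      show 1 + 2 * j + 5 + 2 = 2 * j + 8 by ring]
    simp only [List.map_append, negRev_append, zero_add, ← hU, ← hV]
    clear_value U V
    simp [expand, signedBlock, hp, hblock, run, List.range_succ]
    omega
  have h := ((((h₁.trans h₂).trans h₃).trans h₄).trans h₅.symm).trans h₆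
  convert h using 1
  ring

lemma expand_append (f : ℕ → List ℤ) (A B : List ℤ) :
    expand f (A ++ B) = expand f A ++ expand f B := List.flatMap_append

lemma expand_run_of_forall {f : ℕ → List ℤ} {a b m : ℕ}
    (h : ∀ i < m, f (a + i + 1) = [((b + i + 1 : ℕ) : ℤ)]) : expand f (run a m) = run b m := by
  rw [expand, run, List.flatMap_map, run, List.map_eq_flatMap]
  refine List.flatMap_congr fun i hi => ?_
  rw [signedBlock, if_pos (by positivity), Int.natAbs_natCast, h i (List.mem_range.1 hi)]

lemma expand_map_neg_run_of_forall {f : ℕ → List ℤ} {a b m : ℕ}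
    (h : ∀ i < m, f (a + i + 1) = [((b + i + 1 : ℕ) : ℤ)]) :
    expand f ((run a m).map Neg.neg) = (run b m).map Neg.neg := by
  rw [expand, run, List.map_map, List.flatMap_map, run, List.map_map, List.map_eq_flatMap]
  refine List.flatMap_congr fun i hi => ?_
  simp only [Function.comp_apply]
  rw [signedBlock_neg, signedBlock, if_pos (by positivity), Int.natAbs_natCast,
    h i (List.mem_range.1 hi)]
  rfl

/-- A stack one flip away from the reversed burnt stack yields a way to sort the reversed burnt
stack with one more pancake, using three additional flips. -/
lemma Reach.burntStack_succ {k r m : ℕ}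
    (h : Reach m (sortedStack (k + (1 + r)))
      (negRev ((run 0 k).map Neg.neg) ++ (run k (1 + r)).map Neg.neg)) :
    Reach (3 + m) (burntStack (k + (2 + r))) (sortedStack (k + (2 + r))) := by
  set f : ℕ → List ℤ := fun i =>
    if i ≤ k then [(i : ℤ)] else if i = k + 1 then run k 2 else [((i + 1 : ℕ) : ℤ)] with hf
  have hf₁ : ∀ i < k, f (0 + i + 1) = [((0 + i + 1 : ℕ) : ℤ)] := fun i hi => by
    simp [hf, show i + 1 ≤ k by omega]
  have hf₂ : ∀ i < r, f (k + 1 + i + 1) = [((k + 2 + i + 1 : ℕ) : ℤ)] := fun i _ => by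
    simp only [hf]
    rw [if_neg (by omega), if_neg (by omega), show k + 1 + i + 1 + 1 = k + 2 + i + 1 by ring]
  have hf₃ : expand f [((k + 1 : ℕ) : ℤ)] = run k 2 := by
    rw [expand, List.flatMap_singleton, signedBlock, if_pos (by positivity), Int.natAbs_natCast]
    simp [hf]
  have hf₄ : expand f [-((k + 1 : ℕ) : ℤ)] = negRev (run k 2) := by
    rw [← hf₃, expand, expand, ← negRev_flatMap (signedBlock_neg f)]
    rfl
  have h₁ : expand f (sortedStack (k + (1 + r))) = sortedStack (k + (2 + r)) := by
    simp only [sortedStack_eq_run, run_add k, run_add 0 k, zero_add, expand_append, run_one,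
      expand_run_of_forall hf₁, expand_run_of_forall hf₂, hf₃]
  have h₂ : expand f (negRev ((run 0 k).map Neg.neg) ++ (run k (1 + r)).map Neg.neg) =
      negRev ((run 0 k).map Neg.neg) ++ negRev (run k 2) ++ (run (k + 2) r).map Neg.neg := by
    rw [expand_append, expand, negRev_flatMap (signedBlock_neg f), ← expand, run_add, run_one,
      List.map_append, expand_append, expand_map_neg_run_of_forall hf₁,
      expand_map_neg_run_of_forall hf₂, List.map_singleton, hf₄, List.append_assoc]
  have h₃ := (Reach.flatMap (signedBlock_neg f) h).symm
  change Reach m (expand f _) (expand f _) at h₃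
  rw [h₁, h₂] at h₃
  refine Reach.trans ?_ h₃
  rw [burntStack_eq_run, run_add, run_add, zero_add]
  set B := (run 0 k).map Neg.neg
  set C := (run (k + 2) r).map Neg.neg
  have hr : run k 2 = [(k + 1 : ℤ), (k + 2 : ℤ)] := by
    simp [run, List.range_succ]
    ring
  rw [List.map_append, List.map_append, hr]
  refine Reach.trans (m := 2) (m' := 1) (Reach.trans (m := 1) (m' := 1)
    (Reach.flip' (B ++ [-(k + 1 : ℤ)]) ([-(k + 2 : ℤ)] ++ C) (by simp [B, C]) rfl)
    (Reach.flip' ([(k + 1 : ℤ)] ++ negRev B ++ [-(k + 2 : ℤ)]) C (by simp) rfl))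
    (Reach.flip' ([(k + 2 : ℤ)] ++ B) ([-(k + 1 : ℤ)] ++ C) (by simp) (by simp))

/-- Flip sizes may be assumed to lie in the admissible range. -/
lemma exists_isSortingSeq {n : ℕ} (hn : 0 < n) (ks : List ℕ) {l l' : List ℤ} (hl : l.length = n)
    (h : applyFlips ks l = l') :
    ∃ ks' : List ℕ, (∀ k ∈ ks', 1 ≤ k ∧ k ≤ n) ∧ applyFlips ks' l = l' ∧
      ks'.length ≤ ks.length := by
  induction ks generalizing l with
  | nil => exact ⟨[], by simp, h, le_rfl⟩
  | cons k ks ih =>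
    obtain ⟨ks', h₁, h₂, h₃⟩ := ih (l := pancakeFlip k l) (by simpa using hl) h
    rcases Nat.eq_zero_or_pos k with rfl | hk
    · exact ⟨ks', h₁, by simpa [pancakeFlip] using h₂, by simp; omega⟩
    · refine ⟨min k n :: ks', ?_, ?_, by simpa using h₃⟩
      · simp only [List.mem_cons, forall_eq_or_imp]
        exact ⟨by omega, h₁⟩
      · have : pancakeFlip (min k n) l = pancakeFlip k l := by
          rcases le_total k n with hkn | hkn
          · rw [min_eq_left hkn]
          · rw [min_eq_right hkn, pancakeFlip, pancakeFlip, List.take_of_length_le (by omega),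
              List.drop_eq_nil_of_le (by omega), List.take_of_length_le (by omega),
              List.drop_eq_nil_of_le (by omega)]
        change applyFlips ks' (pancakeFlip (min k n) l) = l'
        rw [this, h₂]

lemma Reach.exists_isSortingSeq {n m : ℕ} (hn : 0 < n)
    (h : Reach m (burntStack n) (sortedStack n)) :
    ∃ ks : List ℕ, IsSortingSeq n ks ∧ ks.length ≤ m := by
  obtain ⟨ks, rfl, h⟩ := h
  obtain ⟨ks', h₁, h₂, h₃⟩ := PancakeSorting.exists_isSortingSeq hn ks
    (by simp [burntStack_eq_run]) h
  exact ⟨ks', ⟨h₁, h₂⟩, h₃⟩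

lemma reach_of_even (n : ℕ) (hn : 14 ≤ n) (heven : Even n) :
    Reach (3 * n / 2 + 2) (burntStack n) (sortedStack n) := by
  obtain ⟨m, rfl⟩ := heven
  rcases eq_or_ne m 7 with rfl | h₁
  · exact ⟨[7, 12, 7, 10, 14, 7, 4, 13, 3, 7, 14, 9, 6, 11, 6, 2, 10, 12, 7, 3, 10, 13, 9], rfl,
      by decide⟩
  rcases eq_or_ne m 9 with rfl | h₂
  · exact ⟨[3, 8, 12, 8, 3, 5, 11, 13, 9, 18, 6, 10, 8, 17, 5, 3, 15, 3, 7, 16, 11, 18, 12, 3, 6,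
      17, 10, 4, 15], rfl, by decide⟩
  rcases Nat.even_or_odd' m with ⟨i, rfl | rfl⟩
  · obtain ⟨j, rfl⟩ : ∃ j, i = j + 4 := ⟨i - 4, by omega⟩
    have h := reach_of_mod_four_eq_three j
    rw [show 15 + 4 * j = (2 * j + 6) + (1 + (2 * j + 8)) by ring,
      show 2 * j + 9 = 1 + (2 * j + 8) by ring] at h
    have hsucc := h.burntStack_succ
    rwa [show 3 + (6 * j + 23) = 3 * (2 * (j + 4) + 2 * (j + 4)) / 2 + 2 by omega,
      show 2 * j + 6 + (2 + (2 * j + 8)) = 2 * (j + 4) + 2 * (j + 4) by ring] at hsucc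
  · obtain ⟨j, rfl⟩ : ∃ j, i = j + 5 := ⟨i - 5, by omega⟩
    have h := reach_of_mod_four_eq_one j
    rw [show 21 + 4 * j = (2 * j + 10) + (1 + (2 * j + 10)) by ring,
      show 2 * j + 11 = 1 + (2 * j + 10) by ring] at h
    have hsucc := h.burntStack_succ
    rwa [show 3 + (6 * j + 32) = 3 * (2 * (j + 5) + 1 + (2 * (j + 5) + 1)) / 2 + 2 by omega,
      show 2 * j + 10 + (2 + (2 * j + 10)) = 2 * (j + 5) + 1 + (2 * (j + 5) + 1) by ring] at hsucc

/-- The type of an adjacency: `1` if correctly oriented, `-1` if upside down, `0` if absent. -/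
def adj (x y : ℤ) : ℤ := if y = x + 1 then 1 else if y = x - 1 then -1 else 0

/-- The type of the adjacency between the lowest pancake and the plate. -/
def plateAdj (n : ℕ) (x : ℤ) : ℤ := if x = n then 1 else if x = -n then -1 else 0

/-- The types of the adjacencies inside a block. -/
def blockAdjs : List ℤ → List ℤ
  | x :: y :: l => adj x y :: blockAdjs (y :: l)
  | _ => []

/-- The types of all adjacencies of a stack, including the one with the plate. -/
def adjs (n : ℕ) : List ℤ → List ℤ
  | x :: y :: l => adj x y :: adjs n (y :: l)
  | [x] => [plateAdj n x]
  | [] => []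

/-- The type of the adjacency between `x` and the stack below it. -/
def nextAdj (n : ℕ) (x : ℤ) : List ℤ → ℤ
  | y :: _ => adj x y
  | [] => plateAdj n x

lemma blockAdjs_concat (A : List ℤ) (x y : ℤ) :
    blockAdjs (A ++ [x] ++ [y]) = blockAdjs (A ++ [x]) ++ [adj x y] := by
  induction A with
  | nil => rfl
  | cons a A ih =>
    cases A with
    | nil => rfl
    | cons b A => simpa [blockAdjs] using ih

lemma adj_neg_neg (x y : ℤ) : adj (-y) (-x) = adj x y := by
  unfold adj; split_ifs <;> omega

lemma blockAdjs_negRev (A : List ℤ) : blockAdjs (negRev A) = (blockAdjs A).reverse := by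
  induction A with
  | nil => rfl
  | cons a A ih =>
    cases A with
    | nil => rfl
    | cons b A =>
      rw [negRev_cons, negRev_cons, blockAdjs_concat, ← negRev_cons, ih, adj_neg_neg]
      simp [blockAdjs]

lemma adjs_append (n : ℕ) (A : List ℤ) (x : ℤ) (B : List ℤ) :
    adjs n (A ++ [x] ++ B) = blockAdjs (A ++ [x]) ++ nextAdj n x B :: adjs n B := by
  induction A with
  | nil => cases B <;> rfl
  | cons a A ih =>
    cases A with
    | nil => simpa [adjs, blockAdjs] using ih
    | cons b A => simpa [adjs, blockAdjs] using ih

/-- Signed permutations, without requiring that every pancake occurs. -/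
def IsStack (n : ℕ) (l : List ℤ) : Prop :=
  (∀ x ∈ l, x ≠ 0 ∧ -n ≤ x ∧ x ≤ n) ∧ (l.map Int.natAbs).Nodup

lemma IsStack.pancakeFlip {n : ℕ} {l : List ℤ} (h : IsStack n l) (k : ℕ) :
    IsStack n (pancakeFlip k l) := by
  obtain ⟨h, h'⟩ := h
  rw [← List.take_append_drop k l] at h h'
  rw [pancakeFlip_eq]
  generalize l.take k = A at *
  generalize l.drop k = B at *
  constructor
  · intro x hx
    simp only [negRev, List.mem_append, List.mem_reverse, List.mem_map] at hx
    rcases hx with ⟨y, hy, rfl⟩ | hx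
    · have := h y (by simp [hy])
      omega
    · exact h x (by simp [hx])
  · refine (List.Perm.nodup_iff ?_).1 h'
    simp only [List.map_append, negRev, List.map_reverse, List.map_map]
    refine List.Perm.append_right _ ?_
    rw [show Int.natAbs ∘ Neg.neg = Int.natAbs from funext Int.natAbs_neg]
    exact (List.reverse_perm _).symm

/-- Consecutive adjacencies never have opposite signs. -/
lemma IsStack.isChain_adjs {n : ℕ} {l : List ℤ} (h : IsStack n l) :
    (adjs n l).IsChain fun a b => a + b = 0 → a = 0 := by
  induction l with
  | nil => simp [adjs]
  | cons x l ih =>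
    have ih := ih ⟨fun y hy => h.1 y (List.mem_cons_of_mem _ hy), (List.nodup_cons.1 h.2).2⟩
    match l with
    | [] => simp [adjs]
    | y :: l =>
      rw [adjs, List.isChain_cons]
      refine ⟨?_, ih⟩
      obtain ⟨h₁, h₂⟩ := h
      match l with
      | [] =>
        have := h₁ x (by simp)
        have := h₁ y (by simp)
        simp only [adjs, adj, plateAdj, List.head?_cons, Option.mem_some_iff, forall_eq']
        grind
      | z :: l =>
        have : x.natAbs ≠ z.natAbs := by
          simp at h₂
          tauto
        simp only [adjs, adj, List.head?_cons, Option.mem_some_iff, forall_eq']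
        grind

lemma mem_blockAdjs {l : List ℤ} {a : ℤ} (h : a ∈ blockAdjs l) : a = 1 ∨ a = -1 ∨ a = 0 := by
  induction l with
  | nil => simp [blockAdjs] at h
  | cons x l ih =>
    cases l with
    | nil => simp [blockAdjs] at h
    | cons y l =>
      simp only [blockAdjs, List.mem_cons] at h
      rcases h with rfl | h
      · unfold adj; grind
      · exact ih h

lemma mem_adjs {n : ℕ} {l : List ℤ} {a : ℤ} (h : a ∈ adjs n l) : a = 1 ∨ a = -1 ∨ a = 0 := by
  induction l with
  | nil => simp [adjs] at h
  | cons x l ih =>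
    cases l with
    | nil =>
      simp only [adjs, List.mem_singleton] at h
      unfold plateAdj at h; grind
    | cons y l =>
      simp only [adjs, List.mem_cons] at h
      rcases h with rfl | h
      · unfold adj; grind
      · exact ih h

/-- The correction between two consecutive adjacencies. -/
def corr (a b : ℤ) : ℤ := if a = b then 0 else a + b

/-- The weight of a sequence of adjacencies. -/
def weight : List ℤ → ℤ
  | a :: b :: l => 6 * a - corr a b + weight (b :: l)
  | [a] => 6 * a
  | [] => 0

lemma weight_append (A : List ℤ) (a b : ℤ) (B : List ℤ) :
    weight (A ++ [a] ++ b :: B) = weight (A ++ [a]) - corr a b + weight (b :: B) := by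
  induction A with
  | nil => rfl
  | cons x A ih =>
    cases A with
    | nil =>
      simp only [List.nil_append, List.cons_append, weight] at ih ⊢
      linarith
    | cons y A =>
      simp only [List.cons_append, weight] at ih ⊢
      linarith

lemma corr_comm (a b : ℤ) : corr a b = corr b a := by
  unfold corr; grind

lemma corr_le {x a h : ℤ} (hx : x = 1 ∨ x = -1 ∨ x = 0) (ha : a = 1 ∨ a = -1 ∨ a = 0)
    (hh : h = 1 ∨ h = -1 ∨ h = 0) (h₁ : x + a = 0 → x = 0) (h₂ : a + h = 0 → a = 0) :
    6 * a - corr x a - corr a h - x ≤ 4 + h := by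
  unfold corr
  split_ifs <;> omega

lemma le_corr {x a h : ℤ} (hx : x = 1 ∨ x = -1 ∨ x = 0) (ha : a = 1 ∨ a = -1 ∨ a = 0)
    (hh : h = 1 ∨ h = -1 ∨ h = 0) (h₁ : x + a = 0 → x = 0) (h₂ : a + h = 0 → a = 0) :
    h - 4 ≤ 6 * a - corr x a - corr a h - x := by
  unfold corr
  split_ifs <;> omega

lemma weight_reverse (A : List ℤ) : weight A.reverse = weight A := by
  induction A with
  | nil => rfl
  | cons a A ih =>
    cases A with
    | nil => rfl
    | cons b A =>
      rw [List.reverse_cons, List.reverse_cons, weight_append, ← List.reverse_cons, ih, weight,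
        corr_comm b a]
      simp only [weight]
      ring

/-- The potential of a sequence of adjacencies. -/
def potential (l : List ℤ) : ℤ := weight l + l.headD 0 + l.getLastD 0

lemma potential_le (A B : List ℤ) (a b : ℤ) (hA : ∀ x ∈ A, x = 1 ∨ x = -1 ∨ x = 0)
    (ha : a = 1 ∨ a = -1 ∨ a = 0) (hb : b = 1 ∨ b = -1 ∨ b = 0)
    (hB : ∀ x ∈ B, x = 1 ∨ x = -1 ∨ x = 0)
    (h₁ : (A ++ a :: B).IsChain fun a b => a + b = 0 → a = 0)
    (h₂ : (A.reverse ++ b :: B).IsChain fun a b => a + b = 0 → a = 0)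
    (h₃ : A ≠ [] ∨ B ≠ []) (h₄ : A = [] ∨ B = [] → ¬ (b = 1 ∧ a = -1)) :
    potential (A.reverse ++ b :: B) ≤ potential (A ++ a :: B) + 8 := by
  have hcorr : ∀ x y : ℤ, corr x y = if x = y then 0 else x + y := fun _ _ => rfl
  rcases A with _ | ⟨x, A⟩
  · rcases B with _ | ⟨h, B⟩
    · simp at h₃
    · have hh := hB h (by simp)
      simp only [List.reverse_nil, List.nil_append, List.isChain_cons_cons] at h₁ h₂
      have h₄ := h₄ (Or.inl rfl)
      simp only [potential, weight, List.reverse_nil, List.nil_append, List.headD_cons,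
        List.getLastD_cons, hcorr]
      split_ifs <;> omega
  · obtain ⟨A', y, hy⟩ : ∃ A' y, x :: A = A' ++ [y] :=
      ⟨_, _, (List.dropLast_append_getLast (List.cons_ne_nil x A)).symm⟩
    have hx : x = 1 ∨ x = -1 ∨ x = 0 := hA x (by simp)
    have hy' : y = 1 ∨ y = -1 ∨ y = 0 := hA y (by simp [hy])
    have hyx : (x :: A).reverse = y :: A'.reverse := by simp [hy]
    have hw₁ : weight (x :: A ++ a :: B) = weight (x :: A) - corr y a + weight (a :: B) := by
      rw [hy, weight_append]
    have hw₂ : weight ((x :: A).reverse ++ b :: B) =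
        weight (x :: A) - corr x b + weight (b :: B) := by
      rw [← weight_reverse (x :: A), List.reverse_cons, weight_append]
    have hc₁ : y + a = 0 → y = 0 := (List.isChain_append.1 h₁).2.2 y (by simp [hy]) a (by simp)
    have hc₂ : x + b = 0 → x = 0 := (List.isChain_append.1 h₂).2.2 x (by simp) b (by simp)
    have hd₁ : (x :: A ++ a :: B).headD 0 = x := rfl
    have hd₂ : ((x :: A).reverse ++ b :: B).headD 0 = y := by rw [hyx]; rfl
    have hlast : ∀ (C : List ℤ) (c : ℤ), (C ++ c :: B).getLastD 0 = B.getLastD c := fun C c => by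
      simp [List.getLast?_cons]
    have hl₁ : (x :: A ++ a :: B).getLastD 0 = B.getLastD a := hlast _ _
    have hl₂ : ((x :: A).reverse ++ b :: B).getLastD 0 = B.getLastD b := hlast _ _
    have h₁ := (List.isChain_append.1 h₁).2.1
    have h₂ := (List.isChain_append.1 h₂).2.1
    rw [potential, potential, hw₁, hw₂, hd₁, hd₂, hl₁, hl₂]
    rcases B with _ | ⟨h, B⟩
    · have h₄ := h₄ (Or.inr rfl)
      simp only [weight, List.getLastD_nil, hcorr]
      split_ifs <;> omega
    · have hh := hB h (by simp)
      simp only [List.isChain_cons_cons] at h₁ h₂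
      have h₃ := corr_le hx hb hh hc₂ h₂.1
      have h₄ := le_corr hy' ha hh hc₁ h₁.1
      simp only [weight, List.getLastD_cons]
      linarith

lemma potential_adjs_pancakeFlip_le {n k : ℕ} {l : List ℤ} (h : IsStack n l)
    (hl : 2 ≤ l.length) (hk : 1 ≤ k) :
    potential (adjs n (pancakeFlip k l)) ≤ potential (adjs n l) + 8 := by
  obtain ⟨x, A, B, rfl, hflip⟩ : ∃ x A B, l = x :: A ++ B ∧
      pancakeFlip k l = negRev (x :: A) ++ B := by
    obtain _ | ⟨x, l⟩ := l
    · simp at hl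
    · obtain ⟨k, rfl⟩ : ∃ i, k = i + 1 := ⟨k - 1, by omega⟩
      exact ⟨x, l.take k, l.drop k, by simp, by simp [pancakeFlip_eq]⟩
  obtain ⟨A', y, hy⟩ : ∃ A' y, x :: A = A' ++ [y] :=
    ⟨_, _, (List.dropLast_append_getLast (List.cons_ne_nil x A)).symm⟩
  have h₁ : adjs n (x :: A ++ B) = blockAdjs (x :: A) ++ nextAdj n y B :: adjs n B := by
    rw [hy, adjs_append]
  have h₂ : adjs n (pancakeFlip k (x :: A ++ B)) =
      (blockAdjs (x :: A)).reverse ++ nextAdj n (-x) B :: adjs n B := by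
    rw [hflip, negRev_cons, adjs_append, ← negRev_cons, blockAdjs_negRev]
  have hc₁ := h.isChain_adjs
  have hc₂ := (h.pancakeFlip k).isChain_adjs
  have hm₁ : ∀ a ∈ adjs n (x :: A ++ B), a = 1 ∨ a = -1 ∨ a = 0 := fun a => mem_adjs
  have hm₂ : ∀ a ∈ adjs n (pancakeFlip k (x :: A ++ B)), a = 1 ∨ a = -1 ∨ a = 0 :=
    fun a => mem_adjs
  rw [h₁] at hc₁ hm₁ ⊢
  rw [h₂] at hc₂ hm₂ ⊢
  refine potential_le _ _ _ _ (fun a => mem_blockAdjs) (hm₁ _ (by simp)) (hm₂ _ (by simp))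
    (fun a => mem_adjs) hc₁ hc₂ ?_ ?_
  · obtain _ | ⟨b, A⟩ := A
    · right
      obtain _ | ⟨b, B⟩ := B
      · simp at hl
      · cases B <;> simp [adjs]
    · left
      simp [blockAdjs]
  · rintro (hA | hB) ⟨h₃, h₄⟩
    · obtain _ | ⟨b, A⟩ := A
      · obtain _ | ⟨b, B⟩ := B
        · simp at hl
        · obtain rfl : y = x := by
            have := congrArg List.getLast? hy
            simpa using this.symm
          have h₅ := h.1 b (by simp)
          simp only [nextAdj, adj] at h₃ h₄
          split_ifs at h₃ h₄ <;> omega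
      · simp [blockAdjs] at hA
    · obtain _ | ⟨b, B⟩ := B
      · have := h.2
        obtain _ | ⟨b, A'⟩ := A'
        · simp_all
        · simp only [nextAdj, plateAdj] at h₃ h₄
          have h₅ := h.1 y (by simp [hy])
          obtain rfl : x = b := by simp_all
          have h₆ : x.natAbs ≠ y.natAbs := by
            simp_all
          split_ifs at h₃ h₄ <;> omega
      · cases B <;> simp [adjs] at hB

lemma isStack_burntStack (n : ℕ) : IsStack n (burntStack n) := by
  rw [burntStack_eq_run]
  constructor
  · intro x hx
    simp only [run, List.mem_map, List.mem_range] at hx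
    obtain ⟨_, ⟨i, hi, rfl⟩, rfl⟩ := hx
    omega
  · simp only [run, List.map_map]
    refine List.Nodup.map (fun i j hij => ?_) List.nodup_range
    simp only [Function.comp_apply] at hij
    omega

lemma adjs_run {n : ℕ} (a m : ℕ) (h : a + m = n) : adjs n (run a m) = List.replicate m 1 := by
  induction m generalizing a with
  | zero => rfl
  | succ m ih =>
    have ih := ih (a + 1) (by omega)
    rw [run_succ]
    cases m with
    | zero => simp [adjs, plateAdj, ← h]
    | succ m =>
      rw [run_succ] at ih ⊢
      rw [adjs, ih, adj, if_pos (by push_cast; ring)]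
      rfl

lemma adjs_map_neg {n : ℕ} (hn : 0 < n) (l : List ℤ) :
    adjs n (l.map Neg.neg) = (adjs n l).map Neg.neg := by
  induction l with
  | nil => rfl
  | cons x l ih =>
    cases l with
    | nil =>
      simp only [adjs, plateAdj, List.map_cons, List.map_nil, List.cons.injEq, and_true]
      split_ifs <;> omega
    | cons y l =>
      simp only [List.map_cons, adjs] at ih ⊢
      rw [ih, List.cons_eq_cons]
      refine ⟨?_, rfl⟩
      unfold adj
      split_ifs <;> omega

lemma potential_replicate {m : ℕ} (hm : 0 < m) (a : ℤ) :
    potential (List.replicate m a) = (6 * m + 2) * a := by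
  have : weight (List.replicate m a) = 6 * m * a := by
    induction m, hm using Nat.le_induction with
    | base => simp [weight]
    | succ m hm ih =>
      obtain ⟨m, rfl⟩ : ∃ i, m = i + 1 := ⟨m - 1, by omega⟩
      rw [List.replicate_succ, List.replicate_succ, weight, ← List.replicate_succ, ih, corr,
        if_pos rfl]
      push_cast
      ring
  rw [potential, this]
  obtain ⟨m, rfl⟩ : ∃ i, m = i + 1 := ⟨m - 1, by omega⟩
  simp [List.getLast?_replicate, List.head?_replicate]
  ring

lemma le_length_of_isSortingSeq {n : ℕ} (hn : 2 ≤ n) {ks : List ℕ} (h : IsSortingSeq n ks) :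
    12 * n + 4 ≤ 8 * ks.length := by
  have key : ∀ (ks : List ℕ) (l : List ℤ), (∀ k ∈ ks, 1 ≤ k) → IsStack n l → 2 ≤ l.length →
      potential (adjs n (applyFlips ks l)) ≤ potential (adjs n l) + 8 * ks.length := by
    intro ks
    induction ks with
    | nil => simp [applyFlips]
    | cons k ks ih =>
      intro l hks hl hlen
      have h₁ := ih (pancakeFlip k l) (fun i hi => hks i (List.mem_cons_of_mem _ hi))
        (hl.pancakeFlip k) (by simpa using hlen)
      have h₂ := potential_adjs_pancakeFlip_le hl hlen (hks k List.mem_cons_self)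
      rw [List.length_cons]
      push_cast
      change potential (adjs n (applyFlips ks (pancakeFlip k l))) ≤ _
      linarith
  have h₁ := key ks (burntStack n) (fun k hk => (h.1 k hk).1) (isStack_burntStack n)
    (by simpa [burntStack_eq_run] using hn)
  rw [h.2, sortedStack_eq_run, burntStack_eq_run, adjs_map_neg (by omega),
    adjs_run 0 n (by omega), List.map_replicate, potential_replicate (by omega),
    potential_replicate (by omega)] at h₁
  omega

end PancakeSorting

open PancakeSorting

/-- For every even integer `n ≥ 14`, `T n = 3n/2 + 1` or `T n = 3n/2 + 2`. -/
theorem T_of_even (n : ℕ) (hn : 14 ≤ n) (heven : Even n) :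
    T n = 3 * n / 2 + 1 ∨ T n = 3 * n / 2 + 2 := by
  obtain ⟨ks, hks, hlen⟩ := (reach_of_even n hn heven).exists_isSortingSeq (by omega)
  have hle : T n ≤ ks.length := Nat.sInf_le ⟨ks, hks, rfl⟩
  obtain ⟨ks', hks', hlen'⟩ : T n ∈ {m | ∃ ks : List ℕ, IsSortingSeq n ks ∧ ks.length = m} :=
    Nat.sInf_mem ⟨_, ks, hks, rfl⟩
  have hge := le_length_of_isSortingSeq (by omega) hks'
  obtain ⟨m, rfl⟩ := heven
  omega
end

section
/- (Cibulka's lower bound, as used in the paper) For every odd integer n ≥ 19, every sequence of flips transforming the burnt stack Ī_n = [-1, -2, ..., -n] into the sorted stack I_n = [1, 2, ..., n] has length at least (3n+3)/2; equivalently, T(n) ≥ (3n+3)/2. -/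
namespace BurntPancake

/-- The sum of `f p q` over all pairs `p, q` of consecutive entries of a list. -/
def pairSum (f : ℤ → ℤ → ℤ) : List ℤ → ℤ
  | p :: q :: l => f p q + pairSum f (q :: l)
  | _ => 0

/-- The number of triples of consecutive entries of the form `p, p - 1, p - 2`. -/
def antiTriples : List ℤ → ℤ
  | p :: q :: r :: l => (if q = p - 1 ∧ r = q - 1 then 1 else 0) + antiTriples (q :: r :: l)
  | _ => 0

/-- The indicator of an antiadjacency on top of the stack. -/
def topAnti : List ℤ → ℤ
  | p :: q :: _ => if q = p - 1 then 1 else 0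
  | _ => 0

/-- The indicator of an adjacency, where `-(n + 1)` below all pancakes plays the role of the
plate: it is adjacent to `n` and antiadjacent to `-n`. -/
def adj (n p q : ℤ) : ℤ :=
  if q = p + 1 ∨ (p = n ∧ q = -(n + 1)) ∨ (p = n + 1 ∧ q = -n) then 1 else 0

/-- The indicator of the antiadjacency between the pancakes `1` and `2`. -/
def antiOneTwo (p q : ℤ) : ℤ :=
  if (p = 2 ∧ q = 1) ∨ (p = -1 ∧ q = -2) then 1 else 0

/-- The pancake `1` is on top, burnt side down, and not adjacent to the pancake `2`. -/
def OneOnTop : List ℤ → Prop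
  | p :: q :: _ => p = 1 ∧ q ≠ 2
  | _ => False

open Classical in
/-- Vanishes as long as `1` and `2` are antiadjacent, and also while `1` is on top. -/
noncomputable def released (l : List ℤ) : ℤ :=
  if 0 < pairSum antiOneTwo l ∨ OneOnTop l then 0 else 1

/-- The potential function: a flip increases it by at most `2`. -/
noncomputable def potential (n : ℤ) (l : List ℤ) : ℤ :=
  2 * pairSum (adj n) l - antiTriples l - topAnti l + released l

lemma pairSum_append (f : ℤ → ℤ → ℤ) (u : List ℤ) (p : ℤ) (v : List ℤ) :
    pairSum f (u ++ p :: v) = pairSum f (u ++ [p]) + pairSum f (p :: v) := by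
  induction u with
  | nil => simp [pairSum]
  | cons a u ih =>
    cases u with
    | nil => simp [pairSum]
    | cons b u => simp only [List.cons_append, pairSum] at ih ⊢; rw [ih]; ring

lemma antiTriples_append (u : List ℤ) (p q : ℤ) (v : List ℤ) :
    antiTriples (u ++ p :: q :: v) = antiTriples (u ++ [p, q]) + antiTriples (p :: q :: v) := by
  induction u with
  | nil => simp [antiTriples]
  | cons a u ih =>
    rcases u with _ | ⟨b, _ | ⟨c, u⟩⟩
    · simp [antiTriples]
    · simp [antiTriples]; ring
    · simp only [List.cons_append, antiTriples] at ih ⊢; rw [ih]; ring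

lemma pairSum_nonneg {f : ℤ → ℤ → ℤ} (hf : ∀ p q, 0 ≤ f p q) (l : List ℤ) :
    0 ≤ pairSum f l := by
  induction l with
  | nil => simp [pairSum]
  | cons p l ih =>
    cases l with
    | nil => simp [pairSum]
    | cons q l => have := hf p q; simp only [pairSum]; omega

lemma pairSum_reverse_map_neg {f : ℤ → ℤ → ℤ} (hf : ∀ p q, f (-q) (-p) = f p q) (l : List ℤ) :
    pairSum f (l.map Neg.neg).reverse = pairSum f l := by
  induction l with
  | nil => rfl
  | cons p l ih =>
    cases l with
    | nil => simp [pairSum]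
    | cons q l =>
      simp only [List.map_cons, List.reverse_cons, List.append_assoc, List.singleton_append]
        at ih ⊢
      rw [pairSum_append, ih]
      simp only [pairSum, hf]
      ring

lemma antiTriples_reverse_map_neg (l : List ℤ) :
    antiTriples (l.map Neg.neg).reverse = antiTriples l := by
  induction l with
  | nil => rfl
  | cons p l ih =>
    rcases l with _ | ⟨q, _ | ⟨r, l⟩⟩
    · simp [antiTriples]
    · simp [antiTriples]
    · simp only [List.map_cons, List.reverse_cons, List.append_assoc, List.cons_append,
        List.nil_append] at ih ⊢
      rw [antiTriples_append, ih]
      simp only [antiTriples]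
      split_ifs <;> omega

lemma adj_neg_neg (n p q : ℤ) : adj n (-q) (-p) = adj n p q := by
  unfold adj; split_ifs <;> omega

lemma adj_nonneg (n p q : ℤ) : 0 ≤ adj n p q := by
  unfold adj; split_ifs <;> omega

lemma adj_eq_one {n p q : ℤ} (h : adj n p q ≠ 0) :
    adj n p q = 1 ∧ (q = p + 1 ∨ (p = n ∧ q = -(n + 1)) ∨ (p = n + 1 ∧ q = -n)) := by
  unfold adj at h ⊢
  split_ifs at h ⊢ with h1
  exacts [⟨rfl, h1⟩, absurd rfl h]

lemma antiOneTwo_neg_neg (p q : ℤ) : antiOneTwo (-q) (-p) = antiOneTwo p q := by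
  unfold antiOneTwo; split_ifs <;> omega

lemma antiOneTwo_nonneg (p q : ℤ) : 0 ≤ antiOneTwo p q := by
  unfold antiOneTwo; split_ifs <;> omega

lemma released_nonneg (l : List ℤ) : 0 ≤ released l := by
  unfold released; split_ifs <;> omega

lemma released_le_one (l : List ℤ) : released l ≤ 1 := by
  unfold released; split_ifs <;> omega

/-- The effect on the potential of turning over the topmost pancake. -/
lemma potential_flip_one {n t q r : ℤ} {v : List ℤ} (hn : 2 ≤ n) (ht' : -n ≤ t)
    (hq : q ≠ 0) (hqn : q ≠ -(n + 1)) (hr : r ≠ 0) (htr : r ≠ -t) :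
    potential n (-t :: q :: r :: v) ≤ potential n (t :: q :: r :: v) + 2 := by
  have h0 := released_nonneg (t :: q :: r :: v)
  have h1 := released_le_one (-t :: q :: r :: v)
  have hrel : released (t :: q :: r :: v) < released (-t :: q :: r :: v) →
      t = 2 ∧ q = 1 ∨ t = 1 := by
    intro h
    have hv := pairSum_nonneg antiOneTwo_nonneg (q :: r :: v)
    unfold released OneOnTop at h
    rw [pairSum.eq_1, pairSum.eq_1 _ (-t)] at h
    unfold antiOneTwo at h hv
    split_ifs at h <;> omega
  have hrel' : released (-t :: q :: r :: v) ≤ released (t :: q :: r :: v) ∨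
      t = 2 ∧ q = 1 ∨ t = 1 := by
    by_cases h : released (t :: q :: r :: v) < released (-t :: q :: r :: v)
    · exact Or.inr (hrel h)
    · exact Or.inl (not_lt.mp h)
  have hA := adj_nonneg n t q
  simp only [potential, pairSum, antiTriples, topAnti]
  by_cases hg : adj n (-t) q = 0
  · rw [hg]
    generalize adj n t q = A at *
    clear hg hrel
    split_ifs <;> omega
  · obtain ⟨hg', hg⟩ := adj_eq_one hg
    rw [hg', if_neg (c := q = t - 1 ∧ r = q - 1) (by omega), if_neg (c := q = t - 1) (by omega)]
    split_ifs <;> omega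

/-- The effect on the potential of turning over the topmost pancakes `P = t :: t' :: a`, where
`P` ends with `p', p`. -/
lemma potential_flip_many {n t t' p p' q r : ℤ} {P a b v : List ℤ} (hn : 2 ≤ n)
    (hP : P = t :: t' :: a) (hP' : P = b ++ [p', p])
    (ht : t ≠ 0) (htn : -n ≤ t) (ht' : t' ≠ 0) (htn' : -n ≤ t') (hq : q ≠ 0) (hr : r ≠ 0)
    (hpt : p ≠ t) (htq : t' ≠ -q) (htr : r ≠ -t) (hpq : p' ≠ q) :
    potential n ((P.map Neg.neg).reverse ++ q :: r :: v) ≤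
      potential n (P ++ q :: r :: v) + 2 := by
  have hR : (P.map Neg.neg).reverse = (a.map Neg.neg).reverse ++ [-t', -t] := by simp [hP]
  have hR' : (P.map Neg.neg).reverse = -p :: -p' :: (b.map Neg.neg).reverse := by simp [hP']
  have hpair (f : ℤ → ℤ → ℤ) : pairSum f (P ++ q :: r :: v) =
      pairSum f P + (f p q + pairSum f (q :: r :: v)) := by
    have := pairSum_append f (b ++ [p']) p (q :: r :: v)
    simp only [List.append_assoc, List.cons_append, List.nil_append] at this
    rw [hP']
    simpa [pairSum] using this
  have hpair' (f : ℤ → ℤ → ℤ) (hf : ∀ p q, f (-q) (-p) = f p q) :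
      pairSum f ((P.map Neg.neg).reverse ++ q :: r :: v) =
      pairSum f P + (f (-t) q + pairSum f (q :: r :: v)) := by
    rw [← pairSum_reverse_map_neg hf P, hR]
    have := pairSum_append f ((a.map Neg.neg).reverse ++ [-t']) (-t) (q :: r :: v)
    simp only [List.append_assoc, List.cons_append, List.nil_append] at this
    simpa [pairSum] using this
  have htrip : antiTriples (P ++ q :: r :: v) =
      antiTriples P + antiTriples (p' :: p :: q :: r :: v) := by
    rw [hP', List.append_assoc, ← antiTriples_append]; rfl
  have htrip' : antiTriples ((P.map Neg.neg).reverse ++ q :: r :: v) =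
      antiTriples P + antiTriples (-t' :: -t :: q :: r :: v) := by
    rw [← antiTriples_reverse_map_neg P, hR, List.append_assoc, ← antiTriples_append]; rfl
  have htop : topAnti (P ++ q :: r :: v) = if t' = t - 1 then 1 else 0 := by
    rw [hP]; rfl
  have htop' : topAnti ((P.map Neg.neg).reverse ++ q :: r :: v) =
      if -p' = -p - 1 then 1 else 0 := by
    rw [hR']; rfl
  have hone : OneOnTop (P ++ q :: r :: v) ↔ t = 1 ∧ t' ≠ 2 := by
    rw [hP]; rfl
  have hone' : OneOnTop ((P.map Neg.neg).reverse ++ q :: r :: v) ↔ -p = 1 ∧ -p' ≠ 2 := by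
    rw [hR']; rfl
  have h0 := released_nonneg (P ++ q :: r :: v)
  have h1 := released_le_one ((P.map Neg.neg).reverse ++ q :: r :: v)
  have hrel : released ((P.map Neg.neg).reverse ++ q :: r :: v) ≤ released (P ++ q :: r :: v) ∨
      p = 2 ∧ q = 1 ∨ t = 1 := by
    by_contra! h
    obtain ⟨h, h2, h3⟩ := h
    have hv := pairSum_nonneg antiOneTwo_nonneg (q :: r :: v)
    have hv' := pairSum_nonneg antiOneTwo_nonneg P
    have hv'' := antiOneTwo_nonneg (-t) q
    unfold released at h
    rw [hpair, hpair' _ antiOneTwo_neg_neg, hone, hone'] at h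
    have : antiOneTwo p q = if (p = 2 ∧ q = 1) ∨ (p = -1 ∧ q = -2) then 1 else 0 := rfl
    split_ifs at h this <;> omega
  simp only [potential, hpair, hpair' _ (adj_neg_neg n), htrip, htrip', htop, htop', antiTriples]
  generalize released ((P.map Neg.neg).reverse ++ q :: r :: v) = z' at *
  generalize released (P ++ q :: r :: v) = z at *
  clear hpair hpair' hR hR' hP hP' htrip htrip' htop htop' hone hone'
  have hA := adj_nonneg n p q
  by_cases hg : adj n (-t) q = 0
  · rw [hg]
    generalize adj n p q = A at *
    clear hg
    split_ifs <;> omega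
  · obtain ⟨hg', hg⟩ := adj_eq_one hg
    rw [hg', if_neg (c := q = p - 1 ∧ r = q - 1) (by omega), if_neg (c := t' = t - 1) (by omega)]
    generalize adj n p q = A at *
    split_ifs <;> omega

/-- The list `l` is a signed permutation of `1, ..., n`. -/
structure IsStack (n : ℕ) (l : List ℤ) : Prop where
  length_eq : l.length = n
  nodup : (l.map Int.natAbs).Nodup
  bounds : ∀ x ∈ l, x ≠ 0 ∧ x.natAbs ≤ n

/-- Two dummy entries placed below the `n` pancakes, so that `potential` sees the bottom. -/
def plate (n : ℤ) : List ℤ := [-(n + 1), -(n + 2)]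

lemma IsStack.pancakeFlip {n : ℕ} {l : List ℤ} (h : IsStack n l) (k : ℕ) :
    IsStack n (pancakeFlip k l) := by
  have hperm : ((_root_.pancakeFlip k l).map Int.natAbs).Perm (l.map Int.natAbs) := by
    have : (l.map Int.natAbs) = (l.take k).map Int.natAbs ++ (l.drop k).map Int.natAbs := by
      rw [← List.map_append, List.take_append_drop]
    rw [this, _root_.pancakeFlip, List.map_append]
    refine List.Perm.append_right _ ?_
    rw [List.map_reverse, List.map_map]
    refine (List.reverse_perm _).trans (List.Perm.of_eq ?_)
    exact List.map_congr_left fun x _ => Int.natAbs_neg x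
  refine ⟨?_, hperm.nodup_iff.2 h.nodup, fun x hx => ?_⟩
  · simpa [h.length_eq] using hperm.length_eq
  · have := hperm.subset (List.mem_map_of_mem (f := Int.natAbs) hx)
    obtain ⟨y, hy, hyx⟩ := List.mem_map.1 this
    have := h.bounds y hy
    omega

lemma burntStack_eq_map (n : ℕ) :
    burntStack n = (List.range n).map fun i : ℕ => -((i : ℤ) + 1) := by
  simp [burntStack, List.map_eq_flatMap, List.flatMap_assoc]

lemma isStack_burntStack (n : ℕ) : IsStack n (burntStack n) := by
  refine ⟨by simp [burntStack], ?_, fun x hx => ?_⟩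
  · rw [burntStack_eq_map, List.map_map]
    exact List.nodup_range.map fun i j hij => by simp only [Function.comp_apply] at hij; omega
  · obtain ⟨i, hi, rfl⟩ := List.mem_map.1 (burntStack_eq_map n ▸ hx)
    have := List.mem_range.1 hi
    omega

lemma potential_flip_le {n : ℕ} (hn : 2 ≤ n) {l : List ℤ} (h : IsStack n l) {k : ℕ}
    (hk : 1 ≤ k) :
    potential n (pancakeFlip k l ++ plate n) ≤ potential n (l ++ plate n) + 2 := by
  have hnodup : ((l ++ plate n).map Int.natAbs).Nodup := by
    rw [List.map_append]
    refine h.nodup.append ?_ ?_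
    · simp only [plate, List.map_cons, List.map_nil, List.nodup_cons, List.mem_singleton,
        List.not_mem_nil, not_false_eq_true, List.nodup_nil, and_true]
      omega
    · intro x hx hx'
      obtain ⟨y, hy, rfl⟩ := List.mem_map.1 hx
      have := h.bounds y hy
      simp only [plate, List.map_cons, List.map_nil, List.mem_cons, List.not_mem_nil,
        or_false] at hx'
      omega
  have hne : ∀ x ∈ l ++ plate n, x ≠ 0 := by
    intro x hx
    rcases List.mem_append.1 hx with hx | hx
    · exact (h.bounds x hx).1
    · simp only [plate, List.mem_cons, List.not_mem_nil, or_false] at hx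
      omega
  obtain ⟨P, hP⟩ : ∃ P, l.take k = P := ⟨_, rfl⟩
  have hPl : ∀ x ∈ P, x ≠ 0 ∧ x.natAbs ≤ n := fun x hx =>
    h.bounds x (List.mem_of_mem_take (hP ▸ hx))
  have hlen : P.length = min k n := by rw [← hP, List.length_take, h.length_eq]
  obtain ⟨q, r, v, hD⟩ : ∃ q r v, l.drop k ++ plate n = q :: r :: v := by
    rcases l.drop k with _ | ⟨d, _ | ⟨e, D⟩⟩
    exacts [⟨_, _, _, rfl⟩, ⟨_, _, _, rfl⟩, ⟨_, _, _, rfl⟩]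
  have hl : l ++ plate n = P ++ q :: r :: v := by
    rw [← hD, ← hP, ← List.append_assoc, List.take_append_drop]
  have hq1 : P.length = 1 → q ≠ -(n + 1) := by
    intro h1 hq
    have hk1 : k = 1 := by omega
    have hlt : 0 < (l.drop k).length := by rw [List.length_drop, h.length_eq]; omega
    obtain ⟨d, D, hdD⟩ := List.exists_cons_of_length_pos hlt
    rw [hdD, List.cons_append, List.cons.injEq] at hD
    have := h.bounds d (List.mem_of_mem_drop (i := k) (hdD ▸ List.mem_cons_self))
    omega
  rw [pancakeFlip, hP, List.append_assoc, hD, hl]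
  rw [hl] at hnodup hne
  have hq := hne q (by simp)
  have hr := hne r (by simp)
  rw [List.map_append, List.nodup_append] at hnodup
  obtain ⟨hnP, -, hdisj⟩ := hnodup
  have hPq : ∀ x ∈ P, x.natAbs ≠ q.natAbs := fun x hx =>
    hdisj _ (List.mem_map_of_mem hx) _ (by simp)
  have hPr : ∀ x ∈ P, x.natAbs ≠ r.natAbs := fun x hx =>
    hdisj _ (List.mem_map_of_mem hx) _ (by simp)
  clear hP hl hD hdisj hne
  rcases P with _ | ⟨t, _ | ⟨t', a⟩⟩
  · simp only [List.length_nil] at hlen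
    omega
  · have ht := hPl t (by simp)
    have := hPr t (by simp)
    exact potential_flip_one (by omega) (by omega) hq (hq1 rfl) hr (by omega)
  · obtain ⟨c, p, hc⟩ := (List.eq_nil_or_concat (t' :: a)).resolve_left (by simp)
    obtain ⟨b, p', hb⟩ := (List.eq_nil_or_concat (t :: c)).resolve_left (by simp)
    have hP' : t :: t' :: a = b ++ [p', p] := by
      rw [hc, List.concat_eq_append, ← List.cons_append, hb]
      simp
    have hp : p ∈ t' :: a := by rw [hc]; simp
    have hp' : p' ∈ t :: t' :: a := by rw [hP']; simp
    have ht := hPl t (by simp)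
    have hpt : p ≠ t := by
      rintro rfl
      rw [List.map_cons, List.nodup_cons] at hnP
      exact hnP.1 (List.mem_map_of_mem hp)
    have ht' := hPl t' (by simp)
    have h1 := hPq t' (by simp)
    have h2 := hPr t (by simp)
    have h3 := hPq p' hp'
    exact potential_flip_many (by omega) rfl hP' ht.1 (by omega) ht'.1 (by omega) hq hr hpt
      (by omega) (by omega) (by rintro rfl; exact h3 rfl)

lemma potential_applyFlips_le {n : ℕ} (hn : 2 ≤ n) (ks : List ℕ) (hks : ∀ k ∈ ks, 1 ≤ k)
    {l : List ℤ} (h : IsStack n l) :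
    potential n (applyFlips ks l ++ plate n) ≤ potential n (l ++ plate n) + 2 * ks.length := by
  induction ks generalizing l with
  | nil => simp [applyFlips]
  | cons k ks ih =>
    have h1 := ih (fun j hj => hks j (List.mem_cons_of_mem _ hj)) (h.pancakeFlip k)
    have h2 := potential_flip_le hn h (hks k List.mem_cons_self)
    have h3 : applyFlips (k :: ks) l = applyFlips ks (pancakeFlip k l) := rfl
    rw [h3, List.length_cons]
    push_cast
    omega

lemma burntStack_succ (n : ℕ) : burntStack (n + 1) = burntStack n ++ [-((n : ℤ) + 1)] := by
  simp [burntStack, List.range_succ]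

lemma sortedStack_succ (n : ℕ) : sortedStack (n + 1) = sortedStack n ++ [(n : ℤ) + 1] := by
  simp [sortedStack, List.range_succ]

lemma burntStack_append_plate (n : ℕ) : burntStack n ++ plate n = burntStack (n + 2) := by
  simp only [burntStack_succ, plate, List.append_assoc, List.cons_append, List.nil_append]
  push_cast
  ring_nf

lemma burntStack_eq_cons (n : ℕ) : ∃ v, burntStack (n + 2) = -1 :: -2 :: v := by
  simp [burntStack, List.range_succ_eq_map]

lemma sortedStack_eq_cons (n : ℕ) : ∃ v, sortedStack (n + 2) = 1 :: 2 :: v := by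
  simp [sortedStack, List.range_succ_eq_map]

lemma antiTriples_burntStack (n : ℕ) : antiTriples (burntStack (n + 2)) = n := by
  induction n with
  | zero => simp [burntStack, List.range_succ, antiTriples]
  | succ n ih =>
    rw [burntStack_succ (n + 2), burntStack_succ (n + 1), burntStack_succ n] at *
    simp only [List.append_assoc, List.cons_append, List.nil_append] at ih ⊢
    rw [antiTriples_append, ih]
    simp only [antiTriples]
    push_cast
    rw [if_pos (by omega)]
    ring

lemma antiTriples_sortedStack (n : ℕ) : antiTriples (sortedStack (n + 2)) = 0 := by
  induction n with
  | zero => simp [sortedStack, List.range_succ, antiTriples]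
  | succ n ih =>
    rw [sortedStack_succ (n + 2), sortedStack_succ (n + 1), sortedStack_succ n] at *
    simp only [List.append_assoc, List.cons_append, List.nil_append] at ih ⊢
    rw [antiTriples_append, ih]
    simp only [antiTriples]
    push_cast
    rw [if_neg (by omega)]
    ring

lemma pairSum_sortedStack {f : ℤ → ℤ → ℤ} {c : ℤ} (hf : ∀ p, 0 ≤ p → f p (p + 1) = c) (n : ℕ) :
    pairSum f (sortedStack (n + 1)) = n * c := by
  induction n with
  | zero => simp [sortedStack, pairSum]
  | succ n ih =>
    rw [sortedStack_succ (n + 1), sortedStack_succ n] at *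
    simp only [List.append_assoc, List.cons_append, List.nil_append] at ih ⊢
    rw [pairSum_append, ih]
    simp only [pairSum]
    push_cast
    rw [hf _ (by omega)]
    ring

lemma potential_burntStack_le (n : ℕ) (hn : 2 ≤ n) :
    potential n (burntStack n ++ plate n) ≤ -n - 1 := by
  have hA (l : ℕ) (hl : l ≤ n + 1) : pairSum (adj n) (burntStack (l + 1)) = 0 := by
    induction l with
    | zero => simp [burntStack, pairSum]
    | succ l ih =>
      have ih := ih (by omega)
      rw [burntStack_succ (l + 1), burntStack_succ l] at *
      simp only [List.append_assoc, List.cons_append, List.nil_append] at ih ⊢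
      rw [pairSum_append, ih]
      simp only [pairSum, adj]
      push_cast
      rw [if_neg (by omega)]
      ring
  rw [burntStack_append_plate, potential, hA (n + 1) le_rfl, antiTriples_burntStack]
  obtain ⟨v, hv⟩ := burntStack_eq_cons n
  have hv0 := pairSum_nonneg antiOneTwo_nonneg (-2 :: v)
  have hJ : 0 < pairSum antiOneTwo (burntStack (n + 2)) := by
    rw [hv, pairSum, antiOneTwo, if_pos (by omega)]
    omega
  rw [released, if_pos (Or.inl hJ), hv]
  simp [topAnti]

lemma le_potential_sortedStack (n : ℕ) (hn : 2 ≤ n) :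
    2 * n + 1 ≤ potential n (sortedStack n ++ plate n) := by
  obtain ⟨m, rfl⟩ := Nat.exists_eq_add_of_le' hn
  have hs : sortedStack (m + 2) ++ plate (m + 2 : ℕ) =
      sortedStack m ++ ((m : ℤ) + 1) :: ((m : ℤ) + 2) :: plate (m + 2 : ℕ) := by
    simp only [sortedStack_succ, List.append_assoc, List.cons_append, List.nil_append]
    push_cast
    ring_nf
  have hs' : sortedStack (m + 2) = sortedStack m ++ [(m : ℤ) + 1, (m : ℤ) + 2] := by
    simp only [sortedStack_succ, List.append_assoc, List.cons_append, List.nil_append]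
    push_cast
    ring_nf
  have hpair {f : ℤ → ℤ → ℤ} {c : ℤ} (hf : ∀ p, 0 ≤ p → f p (p + 1) = c) :
      pairSum f (sortedStack (m + 2) ++ plate (m + 2 : ℕ)) =
        (m + 1) * c + pairSum f (((m : ℤ) + 2) :: plate (m + 2 : ℕ)) := by
    have h1 := pairSum_append f (sortedStack m ++ [(m : ℤ) + 1]) (m + 2) (plate (m + 2 : ℕ))
    have h2 := pairSum_sortedStack hf (m + 1)
    rw [hs'] at h2 ⊢
    simp only [List.append_assoc, List.cons_append, List.nil_append] at h1 h2 ⊢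
    rw [h1, h2]
    push_cast
    ring
  have hA : pairSum (adj (m + 2 : ℕ)) (sortedStack (m + 2) ++ plate (m + 2 : ℕ)) = m + 2 := by
    rw [hpair (c := 1) fun p _ => by rw [adj, if_pos (Or.inl rfl)]]
    simp only [plate, pairSum, adj]
    push_cast
    rw [if_pos (Or.inr (Or.inl ⟨rfl, trivial⟩)), if_neg (by omega)]
    ring
  have hJ : pairSum antiOneTwo (sortedStack (m + 2) ++ plate (m + 2 : ℕ)) = 0 := by
    rw [hpair (c := 0) fun p _ => by rw [antiOneTwo, if_neg (by omega)]]
    simp only [plate, pairSum, antiOneTwo]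
    push_cast
    rw [if_neg (by omega), if_neg (by omega)]
    ring
  have hT : antiTriples (sortedStack (m + 2) ++ plate (m + 2 : ℕ)) = 0 := by
    rw [hs, antiTriples_append, ← hs', antiTriples_sortedStack]
    simp only [plate, antiTriples]
    push_cast
    rw [if_neg (by omega), if_neg (by omega)]
    ring
  obtain ⟨v, hv⟩ := sortedStack_eq_cons m
  have hone : ¬ OneOnTop (sortedStack (m + 2) ++ plate (m + 2 : ℕ)) := by
    rw [hv]
    simp [OneOnTop]
  have htop : topAnti (sortedStack (m + 2) ++ plate (m + 2 : ℕ)) = 0 := by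
    rw [hv]
    simp [topAnti]
  rw [potential, released, if_neg (by rw [hJ]; simpa using hone), hA, hT, htop]
  push_cast
  omega

end BurntPancake

/-- (Cibulka's lower bound) For every odd integer `n ≥ 19`, every sequence of flips
transforming `Ī_n` into `I_n` has length at least `(3n+3)/2`. -/
theorem sorting_seq_length_lower_bound (n : ℕ) (hn : 19 ≤ n) (hodd : Odd n)
    (ks : List ℕ) (hks : IsSortingSeq n ks) :
    (3 * n + 3) / 2 ≤ ks.length := by
  have hn2 : 2 ≤ n := by omega
  have hstep := BurntPancake.potential_applyFlips_le hn2 ks (fun k hk => (hks.1 k hk).1)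
    (BurntPancake.isStack_burntStack n)
  rw [hks.2] at hstep
  have hstart := BurntPancake.potential_burntStack_le n hn2
  have hend := BurntPancake.le_potential_sortedStack n hn2
  obtain ⟨m, rfl⟩ := hodd
  omega
end

section
/- For every integer n ≥ 2, every sequence of flips transforming the burnt stack Ī_n = [-1, -2, ..., -n] into the sorted stack I_n = [1, 2, ..., n] contains the flip of the entire stack (a flip of size n) at least twice. -/
theorem map_natAbs_pancakeFlip_perm (k : ℕ) (l : List ℤ) :
    ((pancakeFlip k l).map Int.natAbs).Perm (l.map Int.natAbs) := by
  have h : (((l.take k).map Neg.neg).reverse.map Int.natAbs).Perm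
      ((l.take k).map Int.natAbs) := by
    refine ((List.reverse_perm _).map _).trans (.of_eq ?_)
    simp [Function.comp_def]
  rw [pancakeFlip, List.map_append]
  refine (h.append_right _).trans (.of_eq ?_)
  rw [← List.map_append, List.take_append_drop]

theorem getLast?_pancakeFlip_of_lt {k : ℕ} {l : List ℤ} (hk : k < l.length) :
    (pancakeFlip k l).getLast? = l.getLast? := by
  have h : l.drop k ≠ [] := by simpa using hk
  conv_rhs => rw [← List.take_append_drop k l]
  rw [pancakeFlip, List.getLast?_append_of_ne_nil _ h, List.getLast?_append_of_ne_nil _ h]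

theorem getLast?_pancakeFlip_length (l : List ℤ) :
    (pancakeFlip l.length l).getLast? = l.head?.map Neg.neg := by
  simp [pancakeFlip]

theorem map_natAbs_applyFlips_perm (ks : List ℕ) (l : List ℤ) :
    ((applyFlips ks l).map Int.natAbs).Perm (l.map Int.natAbs) := by
  induction ks generalizing l with
  | nil => exact .refl _
  | cons k ks ih => exact (ih _).trans (map_natAbs_pancakeFlip_perm k l)

theorem getLast?_applyFlips {ks : List ℕ} {l : List ℤ} (h : ∀ k ∈ ks, k < l.length) :
    (applyFlips ks l).getLast? = l.getLast? := by
  induction ks generalizing l with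
  | nil => rfl
  | cons k ks ih =>
    rw [List.forall_mem_cons] at h
    refine (ih ?_).trans (getLast?_pancakeFlip_of_lt h.1)
    simpa only [length_pancakeFlip] using h.2

theorem length_burntStack (n : ℕ) : (burntStack n).length = n := by
  simp [burntStack]

theorem nodup_map_natAbs_burntStack (n : ℕ) : ((burntStack n).map Int.natAbs).Nodup := by
  have h : (burntStack n).map Int.natAbs = (List.range n).map Nat.succ := by
    simp only [burntStack, bind_pure_comp, List.map_eq_map, List.map_map]
    refine List.map_congr_left fun i _ => ?_
    simp only [Function.comp_apply]
    omega
  rw [h]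
  exact List.nodup_range.map Nat.succ_injective

theorem getLast?_burntStack {n : ℕ} (hn : n ≠ 0) : (burntStack n).getLast? = some (-(n : ℤ)) := by
  obtain ⟨m, rfl⟩ := Nat.exists_eq_succ_of_ne_zero hn
  simp [burntStack, List.range_succ]

theorem getLast?_sortedStack {n : ℕ} (hn : n ≠ 0) : (sortedStack n).getLast? = some (n : ℤ) := by
  obtain ⟨m, rfl⟩ := Nat.exists_eq_succ_of_ne_zero hn
  simp [sortedStack, List.range_succ]

theorem List.Nodup.head?_ne_getLast? {α : Type*} {l : List α} (h : l.Nodup)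
    (hl : 2 ≤ l.length) : l.head? ≠ l.getLast? := by
  rw [List.head?_eq_getElem?, List.getLast?_eq_getElem?]
  intro he
  have := (List.getElem?_inj (by omega) h).1 he
  omega

/-- For every integer `n ≥ 2`, every sequence of flips transforming `Ī_n` into `I_n`
contains the flip of the entire stack at least twice. -/
theorem full_flip_count_ge_two (n : ℕ) (hn : 2 ≤ n)
    (ks : List ℕ) (hks : IsSortingSeq n ks) :
    2 ≤ ks.count n := by
  obtain ⟨hle, hsort⟩ := hks
  have hn0 : n ≠ 0 := by omega
  have hlast := congrArg List.getLast? hsort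
  rw [getLast?_sortedStack hn0] at hlast
  have hlt {js : List ℕ} (hjs : js ⊆ ks) (hmem : n ∉ js) (k : ℕ) (hk : k ∈ js) : k < n :=
    lt_of_le_of_ne (hle k (hjs hk)).2 (ne_of_mem_of_not_mem hk hmem)
  by_contra! hcount
  by_cases hmem : n ∈ ks
  · obtain ⟨as, bs, rfl⟩ := List.append_of_mem hmem
    rw [List.count_append, List.count_cons_self] at hcount
    have has : n ∉ as := List.count_eq_zero.1 (by omega)
    have hbs : n ∉ bs := List.count_eq_zero.1 (by omega)
    set l := applyFlips as (burntStack n) with hl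
    have hlen : l.length = n := (length_applyFlips _ _).trans (length_burntStack n)
    have hbottom : l.getLast? = some (-(n : ℤ)) := by
      rw [hl, getLast?_applyFlips, getLast?_burntStack hn0]
      rw [length_burntStack]
      exact hlt (by simp) has
    have hsplit : applyFlips (as ++ n :: bs) (burntStack n) =
        applyFlips bs (pancakeFlip n l) := by
      simp [hl, applyFlips]
    have htop : l.head? = some (-(n : ℤ)) := by
      have hflip := getLast?_pancakeFlip_length l
      rw [hlen] at hflip
      rw [hsplit, getLast?_applyFlips, hflip, Option.map_eq_some_iff] at hlast
      · obtain ⟨a, ha, han⟩ := hlast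
        rw [ha, ← han, neg_neg]
      · rw [length_pancakeFlip, hlen]
        exact hlt (fun _ hx => by simp [hx]) hbs
    have hnodup : l.Nodup := .of_map Int.natAbs <|
      (map_natAbs_applyFlips_perm as _).nodup_iff.2 (nodup_map_natAbs_burntStack n)
    exact hnodup.head?_ne_getLast? (by omega) (htop.trans hbottom.symm)
  · rw [getLast?_applyFlips, getLast?_burntStack hn0, Option.some_inj] at hlast
    · omega
    · rw [length_burntStack]
      exact hlt (List.Subset.refl _) hmem
end
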